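/- arXiv:1303.7313 — 5 statements merged into one kernel-verified Lean document; each statement's English description precedes it below -/
import Mathlib

section
/- For every pattern π ∈ S_3 and every positive integer n, the number of permutations in S_n that avoid π equals the Catalan number C_n. -/
open Filter Finset Real

/-- `σ` contains the pattern `τ`. -/
def ContainsPattern {n m : ℕ} (σ : Equiv.Perm (Fin n)) (τ : Equiv.Perm (Fin m)) : Prop :=
  ∃ f : Fin m → Fin n, StrictMono f ∧ ∀ a b : Fin m, σ (f a) < σ (f b) ↔ τ a < τ b

/-- `σ` avoids the pattern `τ`. -/
def Avoids {n m : ℕ} (σ : Equiv.Perm (Fin n)) (τ : Equiv.Perm (Fin m)) : Prop :=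
  ¬ ContainsPattern σ τ

/-- The pattern (1,2,3) ∈ S₃ (0-indexed: 0,1,2). -/
def pattern123 : Equiv.Perm (Fin 3) := 1

/-- The pattern (1,3,2) ∈ S₃ (0-indexed: 0,2,1). -/
def pattern132 : Equiv.Perm (Fin 3) := Equiv.swap 1 2

/-- The pattern (3,2,1) ∈ S₃ (0-indexed: 2,1,0). -/
def pattern321 : Equiv.Perm (Fin 3) := Equiv.swap 0 2

/-- The pattern (2,3,1) ∈ S₃ (0-indexed: 1,2,0). -/
def pattern231 : Equiv.Perm (Fin 3) := (Equiv.swap 1 2).trans (Equiv.swap 0 1)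

/-- The refined count of the generating tree. -/
def treeT : ℕ → ℕ → ℕ
  | 0, _ => 1
  | n + 1, k => ∑ j ∈ Finset.range (k + 1), treeT n (j + 1)

lemma treeT_formula (n : ℕ) : ∀ k : ℕ,
    treeT (n + 1) k + (2 * (n + 1) + k).choose n = (2 * (n + 1) + k).choose (n + 1) := by
  induction n with
  | zero =>
    intro k
    simp [treeT]
    omega
  | succ n ih =>
    intro k
    induction k with
    | zero =>
      have h := ih 1
      have e : treeT (n + 1 + 1) 0 = treeT (n + 1) 1 := by simp [treeT]
      rw [e]
      have h1 : (2 * (n + 1 + 1) + 0).choose (n + 1)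
          = (2 * (n + 1) + 1).choose n + (2 * (n + 1) + 1).choose (n + 1) := by
        rw [show 2 * (n + 1 + 1) + 0 = (2 * (n + 1) + 1) + 1 by ring, Nat.choose_succ_succ]
      have h2 : (2 * (n + 1 + 1) + 0).choose (n + 1 + 1)
          = (2 * (n + 1) + 1).choose (n + 1) + (2 * (n + 1) + 1).choose (n + 1 + 1) := by
        rw [show 2 * (n + 1 + 1) + 0 = (2 * (n + 1) + 1) + 1 by ring, Nat.choose_succ_succ]
      have h3 : (2 * (n + 1) + 1).choose (n + 1 + 1) = (2 * (n + 1) + 1).choose (n + 1) := by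
        apply Nat.choose_symm_of_eq_add; omega
      omega
    | succ k ihk =>
      have h := ih (k + 2)
      have e : treeT (n + 1 + 1) (k + 1) = treeT (n + 1 + 1) k + treeT (n + 1) (k + 2) := by
        simp only [treeT, Finset.sum_range_succ _ (k + 1)]
      rw [e]
      have h1 : (2 * (n + 1 + 1) + (k + 1)).choose (n + 1)
          = (2 * (n + 1) + (k + 2)).choose n + (2 * (n + 1) + (k + 2)).choose (n + 1) := by
        rw [show 2 * (n + 1 + 1) + (k + 1) = (2 * (n + 1) + (k + 2)) + 1 by ring,
          Nat.choose_succ_succ]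
      have h2 : (2 * (n + 1 + 1) + (k + 1)).choose (n + 1 + 1)
          = (2 * (n + 1) + (k + 2)).choose (n + 1)
            + (2 * (n + 1) + (k + 2)).choose (n + 1 + 1) := by
        rw [show 2 * (n + 1 + 1) + (k + 1) = (2 * (n + 1) + (k + 2)) + 1 by ring,
          Nat.choose_succ_succ]
      have h3 : 2 * (n + 1 + 1) + k = 2 * (n + 1) + (k + 2) := by ring
      rw [h3] at ihk
      omega

lemma treeT_zero_eq_catalan (n : ℕ) : treeT n 0 = catalan n := by
  cases n with
  | zero => simp [treeT]
  | succ n =>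
    have h := treeT_formula n 0
    have hc := succ_mul_catalan_eq_centralBinom (n + 1)
    rw [Nat.centralBinom] at hc
    simp only [add_zero] at h
    have h2 := Nat.choose_succ_right_eq (2 * (n + 1)) n
    rw [show 2 * (n + 1) - n = n + 2 by omega] at h2
    have : (n + 2) * treeT (n + 1) 0 = (n + 2) * catalan (n + 1) := by nlinarith
    exact Nat.eq_of_mul_eq_mul_left (by omega) this

/-- Prepend the value `p` to the permutation `σ`. -/
noncomputable def consPerm {n : ℕ} (p : Fin (n + 1)) (σ : Equiv.Perm (Fin n)) :
    Equiv.Perm (Fin (n + 1)) :=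
  Equiv.ofBijective (Fin.cons p (fun i => p.succAbove (σ i)) : Fin (n + 1) → Fin (n + 1)) (by
    rw [← Finite.injective_iff_bijective, Fin.cons_injective_iff]
    refine ⟨?_, fun i j h => by simpa using h⟩
    rintro ⟨i, hi⟩
    exact Fin.succAbove_ne _ _ hi)

@[simp] lemma consPerm_zero {n : ℕ} (p : Fin (n + 1)) (σ : Equiv.Perm (Fin n)) :
    consPerm p σ 0 = p := rfl

@[simp] lemma consPerm_succ {n : ℕ} (p : Fin (n + 1)) (σ : Equiv.Perm (Fin n)) (i : Fin n) :
    consPerm p σ i.succ = p.succAbove (σ i) := rfl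

lemma consPerm_bijective (n : ℕ) :
    Function.Bijective (fun x : Equiv.Perm (Fin n) × Fin (n + 1) => consPerm x.2 x.1) := by
  rw [Fintype.bijective_iff_injective_and_card]
  constructor
  · rintro ⟨σ, p⟩ ⟨σ', p'⟩ h
    simp only at h
    have h0 : p = p' := by simpa using congrArg (fun s => s 0) h
    subst h0
    have : σ = σ' := by
      ext i
      have := congrArg (fun s => s i.succ) h
      simp at this
      rw [this]
    rw [this]
  · simp [Fintype.card_perm, Nat.factorial_succ, mul_comm]

open Classical in
lemma tree_step (A : ∀ n, Equiv.Perm (Fin n) → Prop) (t : ∀ n, Equiv.Perm (Fin n) → ℕ)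
    (hA : ∀ n (σ : Equiv.Perm (Fin n)) (p : Fin (n + 1)),
      A (n + 1) (consPerm p σ) ↔ A n σ ∧ t n σ ≤ p)
    (ht : ∀ n (σ : Equiv.Perm (Fin n)) (g : ℕ → ℕ), A n σ →
      (∑ p : Fin (n + 1), if t n σ ≤ p then g (n + 1 - t (n + 1) (consPerm p σ)) else 0)
        = ∑ j ∈ Finset.range (n - t n σ + 1), g (j + 1))
    (n : ℕ) (g : ℕ → ℕ) :
    (∑ σ : Equiv.Perm (Fin (n + 1)), if A (n + 1) σ then g (n + 1 - t (n + 1) σ) else 0)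
      = ∑ σ : Equiv.Perm (Fin n), if A n σ then
          (∑ j ∈ Finset.range (n - t n σ + 1), g (j + 1)) else 0 := by
  rw [← (consPerm_bijective n).sum_comp, Fintype.sum_prod_type]
  refine Finset.sum_congr rfl fun σ _ => ?_
  simp only [hA]
  by_cases h : A n σ
  · simp only [h, true_and, if_true]
    exact ht n σ g h
  · simp [h]

open Classical in
lemma tree_count (A : ∀ n, Equiv.Perm (Fin n) → Prop) (t : ∀ n, Equiv.Perm (Fin n) → ℕ)
    (hA0 : ∀ σ, A 0 σ)
    (hA : ∀ n (σ : Equiv.Perm (Fin n)) (p : Fin (n + 1)),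
      A (n + 1) (consPerm p σ) ↔ A n σ ∧ t n σ ≤ p)
    (ht : ∀ n (σ : Equiv.Perm (Fin n)) (g : ℕ → ℕ), A n σ →
      (∑ p : Fin (n + 1), if t n σ ≤ p then g (n + 1 - t (n + 1) (consPerm p σ)) else 0)
        = ∑ j ∈ Finset.range (n - t n σ + 1), g (j + 1))
    (n : ℕ) : Nat.card {σ : Equiv.Perm (Fin n) // A n σ} = catalan n := by
  have key : ∀ n m, (∑ σ : Equiv.Perm (Fin n), if A n σ then treeT m (n - t n σ) else 0)
      = treeT (n + m) 0 := by
    intro n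
    induction n with
    | zero => intro m; simp [hA0]
    | succ n ih =>
      intro m
      rw [tree_step A t hA ht n (treeT m), show n + 1 + m = n + (m + 1) by ring, ← ih (m + 1)]
      simp only [treeT]
  have h := key n 0
  rw [add_zero, treeT_zero_eq_catalan] at h
  rw [← h, Nat.card_eq_fintype_card, Fintype.card_subtype]
  simp [treeT]

/-- no increasing triple -/
def A123 (n : ℕ) (σ : Equiv.Perm (Fin n)) : Prop :=
  ∀ i j k, i < j → j < k → σ i < σ j → σ j < σ k → False

/-- no 132 triple -/
def A132 (n : ℕ) (σ : Equiv.Perm (Fin n)) : Prop :=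
  ∀ i j k, i < j → j < k → σ i < σ k → σ k < σ j → False

/-- threshold for 123 -/
def t123 (n : ℕ) (σ : Equiv.Perm (Fin n)) : ℕ :=
  Finset.univ.sup fun x : Fin n × Fin n =>
    if x.1 < x.2 ∧ σ x.1 < σ x.2 then (σ x.1 : ℕ) + 1 else 0

/-- threshold for 132 -/
def t132 (n : ℕ) (σ : Equiv.Perm (Fin n)) : ℕ :=
  Finset.univ.sup fun x : Fin n × Fin n =>
    if x.1 < x.2 ∧ σ x.2 < σ x.1 then (σ x.2 : ℕ) + 1 else 0

lemma t123_le (n : ℕ) (σ : Equiv.Perm (Fin n)) (q : ℕ) :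
    t123 n σ ≤ q ↔ ∀ i j, i < j → σ i < σ j → (σ i : ℕ) + 1 ≤ q := by
  simp only [t123, Finset.sup_le_iff, Finset.mem_univ, true_imp_iff, Prod.forall]
  refine forall₂_congr fun i j => ?_
  split_ifs with h
  · simp [h]
  · simp; tauto

lemma t132_le (n : ℕ) (σ : Equiv.Perm (Fin n)) (q : ℕ) :
    t132 n σ ≤ q ↔ ∀ i j, i < j → σ j < σ i → (σ j : ℕ) + 1 ≤ q := by
  simp only [t132, Finset.sup_le_iff, Finset.mem_univ, true_imp_iff, Prod.forall]
  refine forall₂_congr fun i j => ?_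
  split_ifs with h
  · simp [h]
  · simp; tauto

lemma t123_le_n (n : ℕ) (σ : Equiv.Perm (Fin n)) : t123 n σ ≤ n := by
  rw [t123_le]; intros; omega

lemma t132_le_n (n : ℕ) (σ : Equiv.Perm (Fin n)) : t132 n σ ≤ n := by
  rw [t132_le]; intros; omega

lemma val_succAbove {n : ℕ} (p : Fin (n + 1)) (x : Fin n) :
    ((p.succAbove x : Fin (n + 1)) : ℕ) = if (x : ℕ) < p then (x : ℕ) else x + 1 := by
  simp only [Fin.succAbove, Fin.lt_def, Fin.val_castSucc]
  split_ifs <;> simp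

lemma A123_cons (n : ℕ) (σ : Equiv.Perm (Fin n)) (p : Fin (n + 1)) :
    A123 (n + 1) (consPerm p σ) ↔ A123 n σ ∧ t123 n σ ≤ p := by
  rw [t123_le]
  constructor
  · intro h
    refine ⟨fun i j k hij hjk h1 h2 => h i.succ j.succ k.succ (by simpa) (by simpa)
      (by simpa using h1) (by simpa using h2), fun i j hij h1 => ?_⟩
    by_contra hc
    refine h 0 i.succ j.succ (by simp) (by simpa) ?_ (by simpa using h1)
    rw [consPerm_zero, consPerm_succ, Fin.lt_def, val_succAbove]
    split_ifs <;> omega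
  · rintro ⟨h, h'⟩ i j k hij hjk
    cases j using Fin.cases with
    | zero => simp at hij
    | succ j =>
    cases k using Fin.cases with
    | zero => simp at hjk
    | succ k =>
    cases i using Fin.cases with
    | zero =>
      intro h1 h2
      have := h' j k (by simpa using hjk) (by simpa using h2)
      rw [consPerm_zero, consPerm_succ, Fin.lt_def, val_succAbove] at h1
      split_ifs at h1 <;> omega
    | succ i =>
      simpa using h i j k (by simpa using hij) (by simpa using hjk)

lemma A132_cons (n : ℕ) (σ : Equiv.Perm (Fin n)) (p : Fin (n + 1)) :
    A132 (n + 1) (consPerm p σ) ↔ A132 n σ ∧ t132 n σ ≤ p := by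
  rw [t132_le]
  constructor
  · intro h
    refine ⟨fun i j k hij hjk h1 h2 => h i.succ j.succ k.succ (by simpa) (by simpa)
      (by simpa using h1) (by simpa using h2), fun i j hij h1 => ?_⟩
    by_contra hc
    refine h 0 i.succ j.succ (by simp) (by simpa) ?_ (by simpa using h1)
    rw [consPerm_zero, consPerm_succ, Fin.lt_def, val_succAbove]
    split_ifs <;> omega
  · rintro ⟨h, h'⟩ i j k hij hjk
    cases j using Fin.cases with
    | zero => simp at hij
    | succ j =>
    cases k using Fin.cases with
    | zero => simp at hjk
    | succ k =>
    cases i using Fin.cases with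
    | zero =>
      intro h1 h2
      have := h' j k (by simpa using hjk) (by simpa using h2)
      rw [consPerm_zero, consPerm_succ, Fin.lt_def, val_succAbove] at h1
      split_ifs at h1 <;> omega
    | succ i =>
      simpa using h i j k (by simpa using hij) (by simpa using hjk)

lemma t132_cons (n : ℕ) (σ : Equiv.Perm (Fin n)) (p : Fin (n + 1)) (hp : t132 n σ ≤ p) :
    t132 (n + 1) (consPerm p σ) = p := by
  apply le_antisymm
  · rw [t132_le] at hp ⊢
    intro i j hij h
    cases j using Fin.cases with
    | zero => simp at hij
    | succ j =>
    cases i using Fin.cases with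
    | zero => exact Nat.succ_le_of_lt h
    | succ i =>
      have := hp i j (by simpa using hij) (by simpa using h)
      rw [consPerm_succ, val_succAbove]
      split_ifs <;> omega
  · by_contra hc
    have hq := (t132_le (n + 1) (consPerm p σ) (t132 (n + 1) (consPerm p σ))).1 le_rfl
    generalize t132 (n + 1) (consPerm p σ) = q at *
    have hqn : q < n := by omega
    have hx : consPerm p σ ((σ.symm ⟨q, hqn⟩).succ) = ⟨q, by omega⟩ := by
      ext
      rw [consPerm_succ, val_succAbove]
      simp; omega
    have := hq 0 ((σ.symm ⟨q, hqn⟩).succ) (by simp)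
      (by rw [hx, consPerm_zero, Fin.lt_def]; simp; omega)
    rw [hx] at this
    simp at this

lemma t123_cons_lt (n : ℕ) (σ : Equiv.Perm (Fin n)) (p : Fin (n + 1)) (hp : t123 n σ ≤ p)
    (hpn : (p : ℕ) < n) :
    t123 (n + 1) (consPerm p σ) = p + 1 := by
  apply le_antisymm
  · rw [t123_le] at hp ⊢
    intro i j hij h
    cases j using Fin.cases with
    | zero => simp at hij
    | succ j =>
    cases i using Fin.cases with
    | zero => simp
    | succ i =>
      have := hp i j (by simpa using hij) (by simpa using h)
      rw [consPerm_succ, val_succAbove]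
      split_ifs <;> omega
  · have hq := (t123_le (n + 1) (consPerm p σ) (t123 (n + 1) (consPerm p σ))).1 le_rfl
    refine hq 0 ((σ.symm ⟨p, hpn⟩).succ) (by simp) ?_
    rw [consPerm_zero, consPerm_succ, Fin.lt_def, val_succAbove]
    simp

lemma t123_cons_last (n : ℕ) (σ : Equiv.Perm (Fin n)) :
    t123 (n + 1) (consPerm (Fin.last n) σ) = t123 n σ := by
  refine eq_of_forall_ge_iff fun q => ?_
  rw [t123_le, t123_le]
  constructor
  · intro h i j hij h1
    simpa using h i.succ j.succ (by simpa) (by simpa using h1)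
  · intro h i j hij h1
    cases j using Fin.cases with
    | zero => simp at hij
    | succ j =>
    cases i using Fin.cases with
    | zero => exact absurd h1 (by simp [Fin.le_last])
    | succ i => simpa using h i j (by simpa using hij) (by simpa using h1)

lemma sum_aux (g : ℕ → ℕ) (m t : ℕ) (h : t ≤ m) :
    (∑ p ∈ Finset.range m, if t ≤ p then g (m - p) else 0)
      = ∑ j ∈ Finset.range (m - t), g (j + 1) := by
  rw [← Finset.sum_range_reflect, ← Finset.sum_filter]
  refine Finset.sum_bij (fun j _ => j) ?_ ?_ ?_ ?_
  · intro a ha; simp at ha ⊢; omega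
  · intro a _ b _ hab; exact hab
  · intro b hb; simp at hb ⊢; omega
  · intro a ha
    simp at ha
    congr 1; omega

lemma card_A132 (n : ℕ) : Nat.card {σ : Equiv.Perm (Fin n) // A132 n σ} = catalan n := by
  refine tree_count A132 t132 (fun σ i => i.elim0) A132_cons ?_ n
  intro n σ g _
  have hn := t132_le_n n σ
  have : ∀ p : Fin (n + 1), (if t132 n σ ≤ p then g (n + 1 - t132 (n + 1) (consPerm p σ)) else 0)
      = (fun p : ℕ => if t132 n σ ≤ p then g (n + 1 - p) else 0) p := by
    intro p
    by_cases h : t132 n σ ≤ p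
    · simp [h, t132_cons n σ p h]
    · simp [h]
  rw [Finset.sum_congr rfl fun p _ => this p,
    Fin.sum_univ_eq_sum_range (fun p : ℕ => if t132 n σ ≤ p then g (n + 1 - p) else 0), sum_aux _ _ _ (by omega)]
  congr 2; omega

lemma card_A123 (n : ℕ) : Nat.card {σ : Equiv.Perm (Fin n) // A123 n σ} = catalan n := by
  refine tree_count A123 t123 (fun σ i => i.elim0) A123_cons ?_ n
  intro n σ g _
  have hn := t123_le_n n σ
  have : ∀ p : Fin n, (if t123 n σ ≤ (p.castSucc : ℕ) then
        g (n + 1 - t123 (n + 1) (consPerm p.castSucc σ)) else 0)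
      = (fun p : ℕ => if t123 n σ ≤ p then g (n - p) else 0) p := by
    intro p
    by_cases h : t123 n σ ≤ p
    · simp [h, t123_cons_lt n σ p.castSucc (by simpa using h) (by simp)]
    · simp [h]
  rw [Fin.sum_univ_castSucc, Finset.sum_congr rfl fun p _ => this p,
    Fin.sum_univ_eq_sum_range (fun p : ℕ => if t123 n σ ≤ p then g (n - p) else 0),
    sum_aux _ _ _ hn, t123_cons_last, Finset.sum_range_succ]
  simp only [Fin.val_last, hn, if_true]
  congr 2; omega

lemma avoids_one_iff (n : ℕ) (σ : Equiv.Perm (Fin n)) :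
    Avoids σ (1 : Equiv.Perm (Fin 3)) ↔ A123 n σ := by
  constructor
  · intro h i j k hij hjk h1 h2
    refine h ⟨![i, j, k], ?_, ?_⟩
    · rw [Fin.strictMono_iff_lt_succ]
      intro a; fin_cases a <;> simpa
    · intro a b
      fin_cases a <;> fin_cases b <;> simp <;> order
  · rintro h ⟨f, hf, hs⟩
    exact h (f 0) (f 1) (f 2) (hf (by decide)) (hf (by decide)) ((hs 0 1).2 (by decide))
      ((hs 1 2).2 (by decide))

lemma avoids_swap_iff (n : ℕ) (σ : Equiv.Perm (Fin n)) :
    Avoids σ (Equiv.swap 1 2 : Equiv.Perm (Fin 3)) ↔ A132 n σ := by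
  constructor
  · intro h i j k hij hjk h1 h2
    refine h ⟨![i, j, k], ?_, ?_⟩
    · rw [Fin.strictMono_iff_lt_succ]
      intro a; fin_cases a <;> simpa
    · have e0 : (Equiv.swap 1 2 : Equiv.Perm (Fin 3)) 0 = 0 := by decide
      have e1 : (Equiv.swap 1 2 : Equiv.Perm (Fin 3)) 1 = 2 := by decide
      have e2 : (Equiv.swap 1 2 : Equiv.Perm (Fin 3)) 2 = 1 := by decide
      intro a b
      fin_cases a <;> fin_cases b <;> simp [e0, e1, e2] <;> order
  · rintro h ⟨f, hf, hs⟩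
    exact h (f 0) (f 1) (f 2) (hf (by decide)) (hf (by decide)) ((hs 0 2).2 (by decide))
      ((hs 2 1).2 (by decide))

lemma contains_compl {n m : ℕ} (σ : Equiv.Perm (Fin n)) (τ : Equiv.Perm (Fin m))
    (h : ContainsPattern σ τ) : ContainsPattern (Fin.revPerm * σ) (Fin.revPerm * τ) := by
  obtain ⟨f, hf, hs⟩ := h
  exact ⟨f, hf, fun a b => by simpa using hs b a⟩

lemma contains_rev {n m : ℕ} (σ : Equiv.Perm (Fin n)) (τ : Equiv.Perm (Fin m))
    (h : ContainsPattern σ τ) : ContainsPattern (σ * Fin.revPerm) (τ * Fin.revPerm) := by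
  obtain ⟨f, hf, hs⟩ := h
  refine ⟨fun a => (f a.rev).rev, ?_, fun a b => ?_⟩
  · intro a b hab
    simpa using hf (Fin.rev_lt_rev.2 hab)
  · simpa using hs a.rev b.rev

lemma revPerm_mul_self (n : ℕ) : (Fin.revPerm : Equiv.Perm (Fin n)) * Fin.revPerm = 1 := by
  ext; simp

lemma card_compl (n m : ℕ) (τ : Equiv.Perm (Fin m)) :
    Nat.card {σ : Equiv.Perm (Fin n) // Avoids σ (Fin.revPerm * τ)}
      = Nat.card {σ : Equiv.Perm (Fin n) // Avoids σ τ} := by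
  refine (Nat.card_congr ((Equiv.mulLeft Fin.revPerm).subtypeEquiv fun σ => not_congr ⟨?_, ?_⟩)).symm
  · exact contains_compl σ τ
  · intro h
    have := contains_compl _ _ h
    simpa [← mul_assoc, revPerm_mul_self] using this

lemma card_rev (n m : ℕ) (τ : Equiv.Perm (Fin m)) :
    Nat.card {σ : Equiv.Perm (Fin n) // Avoids σ (τ * Fin.revPerm)}
      = Nat.card {σ : Equiv.Perm (Fin n) // Avoids σ τ} := by
  refine (Nat.card_congr ((Equiv.mulRight Fin.revPerm).subtypeEquiv fun σ => not_congr ⟨?_, ?_⟩)).symm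
  · exact contains_rev σ τ
  · intro h
    have := contains_rev _ _ h
    simpa [mul_assoc, revPerm_mul_self] using this

lemma perm_three_cases (p : Equiv.Perm (Fin 3)) :
    p = 1 ∨ p = Fin.revPerm * 1 ∨ p = Equiv.swap 1 2 ∨ p = Fin.revPerm * Equiv.swap 1 2
      ∨ p = Equiv.swap 1 2 * Fin.revPerm ∨ p = Fin.revPerm * (Equiv.swap 1 2 * Fin.revPerm) := by
  revert p; decide

/-- **MacMahon–Knuth.** For every pattern `π ∈ S₃` and every positive integer `n`, the
number of permutations of `{1,…,n}` avoiding `π` equals the Catalan number `C_n`. -/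
theorem card_avoiding_eq_catalan (p : Equiv.Perm (Fin 3)) (n : ℕ) (hn : 0 < n) :
    Nat.card {σ : Equiv.Perm (Fin n) // Avoids σ p} = catalan n := by
  have h1 : Nat.card {σ : Equiv.Perm (Fin n) // Avoids σ (1 : Equiv.Perm (Fin 3))}
      = catalan n := by
    simp only [avoids_one_iff, card_A123]
  have h2 : Nat.card {σ : Equiv.Perm (Fin n) // Avoids σ (Equiv.swap 1 2 : Equiv.Perm (Fin 3))}
      = catalan n := by
    simp only [avoids_swap_iff, card_A132]
  rcases perm_three_cases p with rfl | rfl | rfl | rfl | rfl | rfl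
  · exact h1
  · rw [card_compl, h1]
  · exact h2
  · rw [card_compl, h2]
  · rw [card_rev, h2]
  · rw [card_compl, card_rev, h2]
end

section
/- For all n ≥ 3: P_n(1,1) = P_n(n,n) = 1 and P_n(j,k) ≥ 1 for all 1 ≤ j,k ≤ n (so the minimum of P_n is attained at (1,1) and (n,n)); moreover P_n(j,k) ≤ C_{n-1} for all 1 ≤ j,k ≤ n, and P_n(1,n) = P_n(1,n-1) = P_n(2,n) = P_n(n-1,1) = P_n(n,1) = P_n(n,2) = C_{n-1} (so the maximum C_{n-1} is attained at these six positions). -/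
open Filter Finset Real

/-- `P_n(j,k)`: the number of 123-avoiding permutations of `{1,…,n}` with value `k`
in position `j` (1-indexed). -/
noncomputable def Pcount (n j k : ℕ) : ℕ :=
  Nat.card {σ : Equiv.Perm (Fin n) //
    Avoids σ pattern123 ∧ ∃ i : Fin n, (i : ℕ) + 1 = j ∧ (σ i : ℕ) + 1 = k}

/-- `Q_n(j,k)`: the number of 132-avoiding permutations of `{1,…,n}` with value `k`
in position `j` (1-indexed). -/
noncomputable def Qcount (n j k : ℕ) : ℕ :=
  Nat.card {σ : Equiv.Perm (Fin n) //
    Avoids σ pattern132 ∧ ∃ i : Fin n, (i : ℕ) + 1 = j ∧ (σ i : ℕ) + 1 = k}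

namespace PX

/-- no increasing triple -/
def Av {n : ℕ} (σ : Equiv.Perm (Fin n)) : Prop :=
  ∀ i j k : Fin n, i < j → j < k → σ i < σ j → σ j < σ k → False

lemma av_iff {n : ℕ} (σ : Equiv.Perm (Fin n)) : Avoids σ pattern123 ↔ Av σ := by
  unfold Avoids ContainsPattern pattern123
  constructor
  · intro h i j k hij hjk h1 h2
    apply h
    refine ⟨![i, j, k], ?_, ?_⟩
    · rw [Fin.strictMono_iff_lt_succ]
      intro a
      fin_cases a
      · simpa using hij
      · simpa using hjk
    · have h3 := h1.trans h2
      intro a b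
      fin_cases a <;> fin_cases b <;> simp [h1, h2, h3, h1.le, h2.le, h3.le]
  · rintro h ⟨f, hf, hf2⟩
    exact h (f 0) (f 1) (f 2) (hf (by decide)) (hf (by decide))
      ((hf2 0 1).2 (by decide)) ((hf2 1 2).2 (by decide))

/-- insert value k at position j -/
def ins {n : ℕ} (j k : Fin (n + 1)) (σ : Equiv.Perm (Fin n)) : Equiv.Perm (Fin (n + 1)) :=
  ((finSuccEquiv' j).trans (Equiv.optionCongr σ)).trans (finSuccEquiv' k).symm

@[simp] lemma ins_self {n : ℕ} (j k : Fin (n + 1)) (σ : Equiv.Perm (Fin n)) :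
    ins j k σ j = k := by simp [ins]

@[simp] lemma ins_succAbove {n : ℕ} (j k : Fin (n + 1)) (σ : Equiv.Perm (Fin n)) (i : Fin n) :
    ins j k σ (j.succAbove i) = k.succAbove (σ i) := by simp [ins]

lemma ins_inj {n : ℕ} (j k : Fin (n + 1)) : Function.Injective (ins (n := n) j k) := by
  intro σ τ h
  ext i
  have := congrArg (fun f => f (j.succAbove i)) h
  simp only [ins_succAbove] at this
  rw [Fin.succAbove_right_injective this]

lemma exists_ins {n : ℕ} (j : Fin (n + 1)) (τ : Equiv.Perm (Fin (n + 1))) :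
    ∃ σ, ins j (τ j) σ = τ := by
  have h : ∀ i : Fin n, ∃ m : Fin n, (τ j).succAbove m = τ (j.succAbove i) := by
    intro i
    exact Fin.exists_succAbove_eq (fun h => Fin.succAbove_ne j i (τ.injective h))
  choose f hf using h
  have hinj : Function.Injective f := by
    intro a b hab
    have : τ (j.succAbove a) = τ (j.succAbove b) := by rw [← hf, ← hf, hab]
    exact Fin.succAbove_right_injective (τ.injective this)
  refine ⟨Equiv.ofBijective f (Finite.injective_iff_bijective.1 hinj), ?_⟩
  ext x
  rcases Fin.eq_self_or_eq_succAbove j x with rfl | ⟨i, rfl⟩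
  · simp
  · simp [hf]

lemma av_of_ins {n : ℕ} {j k : Fin (n + 1)} {σ : Equiv.Perm (Fin n)} (h : Av (ins j k σ)) :
    Av σ := by
  intro a b c hab hbc h1 h2
  apply h (j.succAbove a) (j.succAbove b) (j.succAbove c) <;> simpa

/-! ### the tree recursion -/

def Dec {n : ℕ} (σ : Equiv.Perm (Fin n)) (a : ℕ) : Prop :=
  ∀ i j : Fin n, i < j → (j : ℕ) < a → σ j < σ i

open Classical in
noncomputable def L {n : ℕ} (σ : Equiv.Perm (Fin n)) : ℕ := Nat.findGreatest (Dec σ) n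

lemma L_le {n : ℕ} (σ : Equiv.Perm (Fin n)) : L σ ≤ n := by
  classical
  exact Nat.findGreatest_le n

lemma Dec.mono {n : ℕ} {σ : Equiv.Perm (Fin n)} {a b : ℕ} (h : Dec σ b) (hab : a ≤ b) :
    Dec σ a := fun i j hij hj => h i j hij (by omega)

lemma le_L_iff {n : ℕ} (σ : Equiv.Perm (Fin n)) {a : ℕ} (ha : a ≤ n) : a ≤ L σ ↔ Dec σ a := by
  classical
  constructor
  · intro h
    have : Dec σ (L σ) := by
      unfold L
      exact Nat.findGreatest_spec (m := 0) (Nat.zero_le _) (fun i j _ h => by omega)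
    exact this.mono h
  · intro h
    exact Nat.le_findGreatest ha h

lemma L_eq {n : ℕ} (σ : Equiv.Perm (Fin n)) {a : ℕ} (ha : a ≤ n) (h : Dec σ a)
    (h2 : a + 1 ≤ n → ¬ Dec σ (a + 1)) : L σ = a := by
  apply le_antisymm
  · by_contra hc
    push Not at hc
    have h3 := L_le σ
    exact h2 (by omega) ((le_L_iff σ (by omega)).1 hc)
  · exact (le_L_iff σ ha).2 h

lemma av_ins_last {n : ℕ} (p : Fin (n + 1)) (σ : Equiv.Perm (Fin n)) :
    Av (ins p (Fin.last n) σ) ↔ Av σ ∧ (p : ℕ) ≤ L σ := by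
  rw [le_L_iff σ (by omega)]
  constructor
  · intro h
    refine ⟨av_of_ins h, ?_⟩
    intro i j hij hj
    by_contra hc
    have hne : σ i ≠ σ j := fun h => hij.ne (σ.injective h)
    have hlt : σ i < σ j := lt_of_le_of_ne (not_lt.1 hc) hne
    refine h (p.succAbove i) (p.succAbove j) p (by simpa) ?_ (by simpa) (by simp)
    rw [Fin.succAbove_lt_iff_castSucc_lt]
    exact hj
  · rintro ⟨h, hd⟩ x y z hxy hyz h1 h2
    rcases Fin.eq_self_or_eq_succAbove p x with rfl | ⟨i, rfl⟩
    · simp only [ins_self] at h1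
      exact absurd h1 (not_lt.2 (Fin.le_last _))
    rcases Fin.eq_self_or_eq_succAbove p y with rfl | ⟨j, rfl⟩
    · simp only [ins_self] at h2
      exact absurd h2 (not_lt.2 (Fin.le_last _))
    simp only [ins_succAbove, Fin.succAbove_lt_succAbove_iff] at h1 hxy
    rcases Fin.eq_self_or_eq_succAbove p z with rfl | ⟨k, rfl⟩
    · rw [Fin.succAbove_lt_iff_castSucc_lt] at hyz
      exact absurd h1 (not_lt.2 (hd i j hxy hyz).le)
    · simp only [ins_succAbove, Fin.succAbove_lt_succAbove_iff] at h2 hyz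
      exact h i j k hxy hyz h1 h2

lemma L_ins_zero {n : ℕ} (σ : Equiv.Perm (Fin n)) : L (ins 0 (Fin.last n) σ) = L σ + 1 := by
  have h1 := L_le σ
  have key : ∀ a, Dec (ins 0 (Fin.last n) σ) (a + 1) ↔ Dec σ a := by
    intro a
    constructor
    · intro h i j hij hj
      have := h ((0 : Fin (n+1)).succAbove i) ((0 : Fin (n+1)).succAbove j) (by simpa) (by simpa)
      simpa only [ins_succAbove, Fin.succAbove_lt_succAbove_iff] using this
    · intro h x y hxy hy
      rcases Fin.eq_self_or_eq_succAbove 0 y with rfl | ⟨j, rfl⟩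
      · simp at hxy
      rcases Fin.eq_self_or_eq_succAbove 0 x with rfl | ⟨i, rfl⟩
      · rw [ins_succAbove, ins_self]
        simp
      · simp only [ins_succAbove, Fin.succAbove_lt_succAbove_iff] at hxy ⊢
        exact h i j hxy (by simpa using hy)
  apply L_eq _ (by omega)
  · rw [key]
    exact (le_L_iff σ h1).1 le_rfl
  · intro h
    rw [key]
    intro hd
    have := (le_L_iff σ (by omega)).2 hd
    omega

lemma L_ins_pos {n : ℕ} (p : Fin (n + 1)) (hp : (p : ℕ) ≠ 0) (σ : Equiv.Perm (Fin n))
    (h : (p : ℕ) ≤ L σ) : L (ins p (Fin.last n) σ) = p := by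
  have hd := (le_L_iff σ (by omega)).1 h
  apply L_eq _ (by omega)
  · intro x y hxy hy
    rcases Fin.eq_self_or_eq_succAbove p y with rfl | ⟨j, rfl⟩
    · omega
    rcases Fin.eq_self_or_eq_succAbove p x with rfl | ⟨i, rfl⟩
    · omega
    have hy' : p.succAbove j < p := hy
    rw [Fin.succAbove_lt_iff_castSucc_lt] at hy'
    simp only [ins_succAbove, Fin.succAbove_lt_succAbove_iff] at hxy ⊢
    exact hd i j hxy hy'
  · intro _ hc
    have h0 : (0 : Fin (n+1)) < p := by
      rw [Fin.lt_def, Fin.val_zero]; omega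
    have := hc 0 p h0 (Nat.lt_succ_self _)
    simp only [ins_self] at this
    exact absurd this (not_lt.2 (Fin.le_last _))

def T : ℕ → ℕ → ℕ
  | 0, _ => 1
  | m + 1, a => ∑ p ∈ Finset.range (a + 1), T m (p + 1)

lemma ins_bij (n : ℕ) : Function.Bijective
    (fun x : Equiv.Perm (Fin n) × Fin (n + 1) => ins x.2 (Fin.last n) x.1) := by
  constructor
  · rintro ⟨σ, p⟩ ⟨τ, q⟩ h
    dsimp only at h
    have hpq : p = q := by
      apply (ins q (Fin.last n) τ).injective
      rw [ins_self, ← h, ins_self]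
    subst hpq
    rw [ins_inj _ _ h]
  · intro τ
    obtain ⟨σ, hσ⟩ := exists_ins (τ.symm (Fin.last n)) τ
    refine ⟨(σ, τ.symm (Fin.last n)), ?_⟩
    simpa using hσ

open Classical in
lemma sum_step (n : ℕ) (F : ℕ → ℕ) :
    (∑ τ : Equiv.Perm (Fin (n + 1)), if Av τ then F (L τ) else 0) =
    ∑ σ : Equiv.Perm (Fin n), if Av σ then ∑ p ∈ Finset.range (L σ + 1), F (p + 1) else 0 := by
  rw [← (ins_bij n).sum_comp, Fintype.sum_prod_type]
  apply Finset.sum_congr rfl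
  intro σ _
  have hL := L_le σ
  simp only [av_ins_last]
  by_cases h : Av σ
  · simp only [h, true_and, if_true]
    rw [Fin.sum_univ_succ]
    have h1 : ∀ i : Fin n, (if ((i.succ : Fin (n+1)) : ℕ) ≤ L σ then
        F (L (ins i.succ (Fin.last n) σ)) else 0) = if (i : ℕ) < L σ then F (i + 1) else 0 := by
      intro i
      by_cases hi : (i : ℕ) < L σ
      · rw [if_pos hi, if_pos (by simpa using hi), L_ins_pos _ (by simp) _ (by simpa using hi)]
        simp
      · rw [if_neg hi, if_neg (by simpa using hi)]
    simp only [h1, L_ins_zero, Fin.val_zero, Nat.zero_le, if_true]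
    rw [Fin.sum_univ_eq_sum_range (fun i => if i < L σ then F (i + 1) else 0) n,
      Finset.sum_range_succ, ← Finset.sum_filter, add_comm]
    congr 2
    ext x
    simp
    omega
  · simp [h]

open Classical in
lemma sum_T (n : ℕ) : ∀ m : ℕ,
    (∑ τ : Equiv.Perm (Fin n), if Av τ then T m (L τ) else 0) = T (n + m) 0 := by
  induction n with
  | zero =>
    intro m
    have h1 : Av (default : Equiv.Perm (Fin 0)) := fun i => i.elim0
    have h2 := L_le (default : Equiv.Perm (Fin 0))
    rw [Fintype.sum_unique, if_pos h1, Nat.le_zero.1 h2, Nat.zero_add]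
  | succ n ih =>
    intro m
    rw [sum_step, show n + 1 + m = n + (m + 1) by ring, ← ih]
    rfl

lemma T_closed (m : ℕ) : ∀ a, T (m + 1) a + (2 * m + 2 + a).choose m =
    (2 * m + 2 + a).choose (m + 1) := by
  induction m with
  | zero => intro a; simp [T]; omega
  | succ m ih =>
    intro a
    induction a with
    | zero =>
      have h1 : T (m + 2) 0 = T (m + 1) 1 := by simp [T]
      have h2 := ih 1
      rw [← h1] at h2
      have e1 := Nat.choose_succ_succ (2 * m + 3) m
      have e2 := Nat.choose_succ_succ (2 * m + 3) (m + 1)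
      have e3 : (2 * m + 3).choose (m + 2) = (2 * m + 3).choose (m + 1) :=
        Nat.choose_symm_of_eq_add (by omega)
      simp only [Nat.succ_eq_add_one] at e1 e2
      ring_nf at *
      omega
    | succ a iha =>
      have h1 : T (m + 2) (a + 1) = T (m + 2) a + T (m + 1) (a + 2) := by
        simp only [T]
        rw [Finset.sum_range_succ]
      have h2 := ih (a + 2)
      have e1 := Nat.choose_succ_succ (2 * m + 4 + a) m
      have e2 := Nat.choose_succ_succ (2 * m + 4 + a) (m + 1)
      simp only [Nat.succ_eq_add_one] at e1 e2
      ring_nf at *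
      omega

lemma T_catalan (n : ℕ) : T n 0 = catalan n := by
  cases n with
  | zero => simp [T]
  | succ m =>
    have h1 := T_closed m 0
    have h2 := succ_mul_catalan_eq_centralBinom (m + 1)
    have h3 := Nat.choose_succ_right_eq (2 * m + 2) m
    rw [Nat.centralBinom, show 2 * (m + 1) = 2 * m + 2 by ring] at h2
    rw [show 2 * m + 2 - m = m + 2 by omega] at h3
    simp only [add_zero] at h1
    have : (m + 1 + 1) * T (m + 1) 0 = (m + 1 + 1) * catalan (m + 1) := by
      rw [h2]
      nlinarith
    exact Nat.eq_of_mul_eq_mul_left (by omega) this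

lemma card_av (n : ℕ) : {σ : Equiv.Perm (Fin n) | Av σ}.ncard = catalan n := by
  classical
  rw [← T_catalan, ← Nat.add_zero n, ← sum_T n 0, Set.ncard_eq_toFinset_card']
  simp [T]

/-! ### counts -/

lemma Pcount_eq (n : ℕ) (i l : Fin (n + 1)) :
    Pcount (n + 1) (i + 1) (l + 1) = {τ : Equiv.Perm (Fin (n + 1)) | Av τ ∧ τ i = l}.ncard := by
  unfold Pcount
  rw [← Nat.card_coe_set_eq]
  apply Nat.card_congr
  apply Equiv.subtypeEquivRight
  intro σ
  rw [av_iff]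
  apply and_congr_right
  intro _
  constructor
  · rintro ⟨x, hx, h⟩
    have : x = i := Fin.ext (by omega)
    subst this
    exact Fin.ext (by omega)
  · rintro rfl
    exact ⟨i, rfl, rfl⟩

lemma set_sub {n : ℕ} (i l : Fin (n + 1)) :
    {τ : Equiv.Perm (Fin (n + 1)) | Av τ ∧ τ i = l} ⊆ ins i l '' {σ | Av σ} := by
  rintro τ ⟨h, rfl⟩
  obtain ⟨σ, hσ⟩ := exists_ins i τ
  rw [← hσ] at h
  exact ⟨σ, av_of_ins h, hσ⟩

lemma upper (n : ℕ) (i l : Fin (n + 1)) : Pcount (n + 1) (i + 1) (l + 1) ≤ catalan n := by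
  rw [Pcount_eq, ← card_av, ← Set.ncard_image_of_injective _ (ins_inj i l)]
  exact Set.ncard_le_ncard (set_sub i l) (Set.toFinite _)

lemma av_ins {n : ℕ} (i l : Fin (n + 1)) (σ : Equiv.Perm (Fin n)) (h : Av σ)
    (h1 : ∀ a b, a < b → σ a < σ b → i ≤ a.castSucc → l ≤ (σ a).castSucc → False)
    (h2 : ∀ a b, a < b → σ a < σ b → a.castSucc < i → i ≤ b.castSucc →
      (σ a).castSucc < l → l ≤ (σ b).castSucc → False)
    (h3 : ∀ a b, a < b → σ a < σ b → b.castSucc < i → (σ b).castSucc < l → False) :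
    Av (ins i l σ) := by
  intro x y z hxy hyz hx hy
  rcases Fin.eq_self_or_eq_succAbove i x with hx0 | ⟨a, hx0⟩ <;>
  rcases Fin.eq_self_or_eq_succAbove i y with hy0 | ⟨b, hy0⟩ <;>
  rcases Fin.eq_self_or_eq_succAbove i z with hz0 | ⟨c, hz0⟩ <;>
  rw [hx0, hy0] at hxy hx <;> rw [hy0, hz0] at hyz hy <;>
  simp only [ins_self, ins_succAbove, Fin.succAbove_lt_succAbove_iff,
    Fin.succAbove_lt_iff_castSucc_lt, Fin.lt_succAbove_iff_le_castSucc, lt_irrefl] at hxy hyz hx hy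
  · exact absurd hxy (not_le.2 hyz)
  · exact h1 b c hyz hy hxy hx
  · exact h2 a c (by rw [← Fin.castSucc_lt_castSucc_iff]; exact hxy.trans_le hyz)
      (by rw [← Fin.castSucc_lt_castSucc_iff]; exact hx.trans_le hy) hxy hyz hx hy
  · exact h3 a b hxy hx hyz hy
  · exact h a b c hxy hyz hx hy

lemma rev_no {n : ℕ} (a b : Fin n) (h : a < b) (h2 : Fin.revPerm a < Fin.revPerm b) : False := by
  simp at h2
  exact absurd h (not_lt.2 h2.le)

lemma rev_mem {n : ℕ} (i l : Fin (n + 1)) :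
    ins i l Fin.revPerm ∈ {τ : Equiv.Perm (Fin (n + 1)) | Av τ ∧ τ i = l} := by
  refine ⟨av_ins i l _ ?_ ?_ ?_ ?_, by simp⟩
  · intro a b c h _ h2 _
    exact rev_no a b h h2
  all_goals
    intro a b h h2
    exact (rev_no a b h h2).elim

lemma lower (n : ℕ) (i l : Fin (n + 1)) : 1 ≤ Pcount (n + 1) (i + 1) (l + 1) := by
  rw [Pcount_eq, Nat.one_le_iff_ne_zero]
  exact Set.ncard_ne_zero_of_mem (rev_mem i l)

lemma eq_rev {n : ℕ} (σ : Equiv.Perm (Fin n)) (h : ∀ a b, a < b → σ a < σ b → False) :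
    σ = Fin.revPerm := by
  have hs : StrictMono (fun a => Fin.rev (σ a)) := by
    intro a b hab
    have : σ b ≤ σ a := not_lt.1 (h a b hab)
    have hne : σ b ≠ σ a := fun h => hab.ne' (σ.injective h)
    simpa using lt_of_le_of_ne this hne
  have : (fun a => Fin.rev (σ a)) = id := by
    apply (StrictMono.range_inj hs strictMono_id).1
    rw [Set.range_id, Set.range_eq_univ]
    exact Fin.rev_surjective.comp σ.surjective
  apply Equiv.ext
  intro a
  have h1 := congrFun this a
  simp only [id] at h1
  rw [Fin.revPerm_apply]
  exact Fin.rev_eq_iff.1 h1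

lemma one_of (n : ℕ) (i l : Fin (n + 1))
    (H : ∀ σ : Equiv.Perm (Fin n), Av (ins i l σ) → ∀ a b, a < b → σ a < σ b → False) :
    Pcount (n + 1) (i + 1) (l + 1) = 1 := by
  rw [Pcount_eq, Set.ncard_eq_one]
  refine ⟨ins i l Fin.revPerm, ?_⟩
  apply Set.Subset.antisymm
  · rintro τ ⟨h, rfl⟩
    obtain ⟨σ, hσ⟩ := exists_ins i τ
    have h2 := h
    rw [← hσ] at h2
    rw [Set.mem_singleton_iff, ← eq_rev σ (H σ h2), hσ]
  · rintro τ rfl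
    exact rev_mem i l

lemma full (n : ℕ) (i l : Fin (n + 1))
    (H : ∀ σ : Equiv.Perm (Fin n), Av σ → Av (ins i l σ)) :
    Pcount (n + 1) (i + 1) (l + 1) = catalan n := by
  rw [Pcount_eq, ← card_av, ← Set.ncard_image_of_injective _ (ins_inj i l)]
  congr 1
  apply Set.Subset.antisymm (set_sub i l)
  rintro _ ⟨σ, h, rfl⟩
  exact ⟨H σ h, by simp⟩

/-- the six corner positions -/
lemma full' (n j k : ℕ) (hj : 1 ≤ j) (hj' : j ≤ n + 1) (hk : 1 ≤ k) (hk' : k ≤ n + 1)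
    (h : (j + n ≤ k + 1) ∨ (k + n ≤ j + 1)) :
    Pcount (n + 1) j k = catalan n := by
  obtain ⟨j, rfl⟩ := Nat.exists_eq_add_of_le' hj
  obtain ⟨k, rfl⟩ := Nat.exists_eq_add_of_le' hk
  refine full n ⟨j, by omega⟩ ⟨k, by omega⟩ ?_
  intro σ hσ
  apply av_ins _ _ _ hσ
  all_goals
    intro a b
    have := (σ a).isLt
    have := (σ b).isLt
    simp only [Fin.lt_def, Fin.le_def, Fin.val_castSucc]
    omega

end PX

/-- Extreme values of `P_n`: for `n ≥ 3`, the minimum value `1` is attained at `(1,1)`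
and `(n,n)`, and the maximum value `C_{n-1}` is attained at the six positions
`(1,n), (1,n-1), (2,n), (n-1,1), (n,1), (n,2)`. -/
theorem Pcount_extreme (n : ℕ) (hn : 3 ≤ n) :
    Pcount n 1 1 = 1 ∧ Pcount n n n = 1 ∧
    (∀ j k : ℕ, 1 ≤ j → j ≤ n → 1 ≤ k → k ≤ n →
      1 ≤ Pcount n j k ∧ Pcount n j k ≤ catalan (n - 1)) ∧
    Pcount n 1 n = catalan (n - 1) ∧ Pcount n 1 (n - 1) = catalan (n - 1) ∧
    Pcount n 2 n = catalan (n - 1) ∧ Pcount n (n - 1) 1 = catalan (n - 1) ∧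
    Pcount n n 1 = catalan (n - 1) ∧ Pcount n n 2 = catalan (n - 1) := by
  obtain ⟨n, rfl⟩ : ∃ m, n = m + 1 := ⟨n - 1, by omega⟩
  simp only [Nat.add_sub_cancel]
  refine ⟨?_, ?_, ?_, ?_, ?_, ?_, ?_, ?_, ?_⟩
  · refine PX.one_of n 0 0 ?_
    intro σ h a b hab h2
    refine h 0 ((0 : Fin (n+1)).succAbove a) ((0 : Fin (n+1)).succAbove b) (by simp) (by simpa)
      ?_ (by simpa only [PX.ins_succAbove, Fin.succAbove_lt_succAbove_iff])
    rw [PX.ins_succAbove, PX.ins_self]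
    simp
  · refine PX.one_of n (Fin.last n) (Fin.last n) ?_
    intro σ h a b hab h2
    refine h ((Fin.last n).succAbove a) ((Fin.last n).succAbove b) (Fin.last n) (by simpa) (by simp)
      (by simpa only [PX.ins_succAbove, Fin.succAbove_lt_succAbove_iff]) ?_
    rw [PX.ins_succAbove, PX.ins_self]
    simp
  · intro j k hj hj' hk hk'
    obtain ⟨j, rfl⟩ := Nat.exists_eq_add_of_le' hj
    obtain ⟨k, rfl⟩ := Nat.exists_eq_add_of_le' hk
    exact ⟨PX.lower n ⟨j, by omega⟩ ⟨k, by omega⟩, PX.upper n ⟨j, by omega⟩ ⟨k, by omega⟩⟩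
  all_goals
    apply PX.full' <;> omega
end

section
/- For all n ≥ 4: Q_n(1,1) = 1 and Q_n(j,k) ≥ 1 for all 1 ≤ j,k ≤ n (so the minimum of Q_n is attained at (1,1)); moreover Q_n(j,k) ≤ C_{n-1} for all 1 ≤ j,k ≤ n, and Q_n(1,n) = Q_n(1,n-1) = Q_n(n-1,1) = Q_n(n,1) = Q_n(n,n) = C_{n-1} (so the maximum C_{n-1} is attained at these five positions). -/
open Filter Finset Real

/-- Elementary form of 132-avoidance. -/
def Av {n : ℕ} (σ : Equiv.Perm (Fin n)) : Prop :=
  ∀ i j l : Fin n, i < j → j < l → σ i < σ l → σ l < σ j → False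

theorem avoids_iff {n : ℕ} (σ : Equiv.Perm (Fin n)) : Avoids σ pattern132 ↔ Av σ := by
  have p0 : pattern132 0 = 0 := by decide
  have p1 : pattern132 1 = 2 := by decide
  have p2 : pattern132 2 = 1 := by decide
  constructor
  · intro h i j l hij hjl h1 h2
    apply h
    refine ⟨![i, j, l], ?_, ?_⟩
    · intro a b hab
      fin_cases a <;> fin_cases b <;> simp_all <;> first | exact hij.trans hjl | omega
    · have h3 := h1.trans h2
      intro a b
      fin_cases a <;> fin_cases b <;> simp [p0, p1, p2, h1, h2, h3, h1.le, h2.le, h3.le]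
  · rintro h ⟨f, hf, hh⟩
    refine h (f 0) (f 1) (f 2) (hf (by decide)) (hf (by decide)) ?_ ?_
    · rw [hh, p0, p2]; decide
    · rw [hh, p1, p2]; decide

/-- Insert the point `(p, k)` into a permutation. -/
def ins {n : ℕ} (p k : Fin (n + 1)) (τ : Equiv.Perm (Fin n)) : Equiv.Perm (Fin (n + 1)) :=
  ((finSuccEquiv' p).trans (Equiv.optionCongr τ)).trans (finSuccEquiv' k).symm

theorem ins_self {n : ℕ} (p k : Fin (n + 1)) (τ : Equiv.Perm (Fin n)) : ins p k τ p = k := by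
  simp [ins]

theorem ins_succAbove {n : ℕ} (p k : Fin (n + 1)) (τ : Equiv.Perm (Fin n)) (i : Fin n) :
    ins p k τ (p.succAbove i) = k.succAbove (τ i) := by
  simp [ins]

theorem ins_inj {n : ℕ} (p k : Fin (n + 1)) : Function.Injective (ins p k) := by
  intro a b h
  ext i
  have := congrArg (fun e => e (p.succAbove i)) h
  simp only [ins_succAbove] at this
  rw [Fin.succAbove_right_injective this]

theorem ins_surj {n : ℕ} (p k : Fin (n + 1)) (σ : Equiv.Perm (Fin (n + 1))) (h : σ p = k) :
    ∃ τ, ins p k τ = σ := by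
  let e : Option (Fin n) ≃ Option (Fin n) :=
    ((finSuccEquiv' p).symm.trans σ).trans (finSuccEquiv' k)
  have he : e none = none := by simp [e, h]
  refine ⟨Equiv.removeNone e, ?_⟩
  have h2 : Equiv.optionCongr (Equiv.removeNone e) = e := by
    ext1 x
    cases x with
    | none => simp [he]
    | some x =>
      have : e (some x) ≠ none := by
        intro h3
        rw [← he] at h3
        simpa using e.injective h3
      rw [Equiv.optionCongr_apply, Option.map_some]
      exact Equiv.removeNone_some e (Option.ne_none_iff_exists'.1 this)
  unfold ins
  rw [h2]
  ext1 x
  simp [e]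

theorem succAbove_val {n : ℕ} (k : Fin (n + 1)) (x : Fin n) :
    ((k.succAbove x : Fin (n + 1)) : ℕ) = if (x : ℕ) < k then (x : ℕ) else x + 1 := by
  unfold Fin.succAbove
  simp only [Fin.lt_def, Fin.val_castSucc]
  split_ifs <;> simp

theorem av_of_ins {n : ℕ} {p k : Fin (n + 1)} {τ : Equiv.Perm (Fin n)} (h : Av (ins p k τ)) :
    Av τ := by
  intro i j l hij hjl h1 h2
  refine h (p.succAbove i) (p.succAbove j) (p.succAbove l)
    (Fin.strictMono_succAbove p hij) (Fin.strictMono_succAbove p hjl) ?_ ?_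
  · rw [ins_succAbove, ins_succAbove]; exact Fin.strictMono_succAbove k h1
  · rw [ins_succAbove, ins_succAbove]; exact Fin.strictMono_succAbove k h2

/-- General criterion for insertion. -/
theorem av_ins {n : ℕ} {p k : Fin (n + 1)} {τ : Equiv.Perm (Fin n)} (h : Av τ)
    (hA : ∀ j l : Fin n, j < l → (p : ℕ) ≤ j → τ l < τ j → (k : ℕ) ≤ τ l → False)
    (hB : ∀ i l : Fin n, i < l → (i : ℕ) < p → (p : ℕ) ≤ l → τ i < τ l →
      (τ l : ℕ) < k → False)
    (hC : ∀ i j : Fin n, i < j → (j : ℕ) < p → τ i < τ j → (τ i : ℕ) < k →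
      (k : ℕ) ≤ τ j → False) : Av (ins p k τ) := by
  intro i j l hij hjl h1 h2
  rcases Fin.eq_self_or_eq_succAbove p i with ei | ⟨i, rfl⟩ <;>
  rcases Fin.eq_self_or_eq_succAbove p j with ej | ⟨j, rfl⟩ <;>
  rcases Fin.eq_self_or_eq_succAbove p l with el | ⟨l, rfl⟩ <;>
  (try subst ei) <;> (try subst ej) <;> (try subst el) <;>
  simp only [ins_succAbove, ins_self, lt_self_iff_false] at hij hjl h1 h2 <;>
  simp only [Fin.lt_def, succAbove_val] at hij hjl h1 h2
  · refine hA j l ?_ ?_ ?_ ?_ <;> (try rw [Fin.lt_def]) <;> split_ifs at * <;> omega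
  · refine hB i l ?_ ?_ ?_ ?_ ?_ <;> (try rw [Fin.lt_def]) <;> split_ifs at * <;> omega
  · refine hC i j ?_ ?_ ?_ ?_ ?_ <;> (try rw [Fin.lt_def]) <;> split_ifs at * <;> omega
  · refine h i j l ?_ ?_ ?_ ?_ <;> rw [Fin.lt_def] <;> split_ifs at * <;> omega

theorem av_ins_zero_iff {n : ℕ} (k : Fin (n + 2)) (τ : Equiv.Perm (Fin (n + 1))) :
    Av (ins 0 k τ) ↔ Av τ ∧ (τ 0 : ℕ) ≤ k := by
  constructor
  · intro h
    refine ⟨av_of_ins h, ?_⟩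
    by_contra hlt
    push Not at hlt
    obtain ⟨l, hl⟩ := τ.surjective ⟨(τ 0 : ℕ) - 1, by omega⟩
    have hl' : (τ l : ℕ) = (τ 0 : ℕ) - 1 := by rw [hl]
    have hl0 : (0 : Fin (n + 1)) < l := by
      rw [Fin.pos_iff_ne_zero]
      rintro rfl
      omega
    refine h 0 (Fin.succAbove 0 0) (Fin.succAbove 0 l) ?_ (Fin.strictMono_succAbove 0 hl0) ?_ ?_
    · simp
    · rw [ins_self, ins_succAbove, Fin.lt_def, succAbove_val]
      split_ifs <;> omega
    · rw [ins_succAbove, ins_succAbove, Fin.lt_def, succAbove_val, succAbove_val]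
      split_ifs <;> omega
  · rintro ⟨h, hk⟩
    refine av_ins h ?_ ?_ ?_
    · intro j l hjl _ h1 h2
      have hl : τ l ≠ τ 0 := fun e => by
        have := τ.injective e
        subst this
        simp at hjl
      have hl' : (τ 0 : ℕ) ≠ τ l := fun e => hl (Fin.ext e.symm)
      have h3 : τ 0 < τ l := by rw [Fin.lt_def]; omega
      have hj : (0 : Fin (n + 1)) < j := by
        rw [Fin.pos_iff_ne_zero]
        rintro rfl
        exact absurd h3 (by simp [h1.le])
      exact h 0 j l hj hjl h3 h1
    · intro i l _ h1; simp at h1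
    · intro i l _ h1; simp at h1

/-- The number of avoiders. -/
noncomputable def T (n : ℕ) : ℕ := Nat.card {σ : Equiv.Perm (Fin n) // Av σ}

theorem Qcount_eq {n : ℕ} (p k : Fin (n + 1)) :
    Qcount (n + 1) (p + 1) (k + 1) = Nat.card {τ : Equiv.Perm (Fin n) // Av (ins p k τ)} := by
  unfold Qcount
  symm
  refine Nat.card_congr (Equiv.ofBijective
    (fun τ => ⟨ins p k τ.1, (avoids_iff _).2 τ.2, p, rfl, by rw [ins_self]⟩) ⟨?_, ?_⟩)
  · intro a b h
    exact Subtype.ext (ins_inj p k (congrArg Subtype.val h))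
  · rintro ⟨σ, hσ, i, hi, hk⟩
    have hi' : i = p := Fin.ext (by omega)
    subst hi'
    obtain ⟨τ, rfl⟩ := ins_surj i k σ (Fin.ext (by omega))
    exact ⟨⟨τ, (avoids_iff _).1 hσ⟩, rfl⟩

theorem Qcount_le {n : ℕ} (p k : Fin (n + 1)) : Qcount (n + 1) (p + 1) (k + 1) ≤ T n := by
  rw [Qcount_eq]
  exact Nat.card_le_card_of_injective
    (fun τ : {τ : Equiv.Perm (Fin n) // Av (ins p k τ)} =>
      (⟨τ.1, av_of_ins τ.2⟩ : {σ : Equiv.Perm (Fin n) // Av σ}))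
    (fun a b h => Subtype.ext (by simpa using h))

theorem Qcount_eq_T {n : ℕ} (p k : Fin (n + 1))
    (h : ∀ τ : Equiv.Perm (Fin n), Av τ → Av (ins p k τ)) :
    Qcount (n + 1) (p + 1) (k + 1) = T n := by
  rw [Qcount_eq]
  exact Nat.card_congr (Equiv.subtypeEquivRight fun τ => ⟨av_of_ins, h τ⟩)

/-- Avoiders of size `n+1` with first value at most `k`. -/
noncomputable def B (n k : ℕ) : ℕ :=
  Nat.card {σ : Equiv.Perm (Fin (n + 1)) // Av σ ∧ (σ 0 : ℕ) ≤ k}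

theorem Q_first {n k : ℕ} (hk : k ≤ n + 1) : Qcount (n + 2) 1 (k + 1) = B n k := by
  have := Qcount_eq (n := n + 1) 0 ⟨k, by omega⟩
  simp only [Fin.val_zero, zero_add] at this
  rw [this]
  exact Nat.card_congr (Equiv.subtypeEquivRight fun τ => av_ins_zero_iff _ τ)

theorem B_top {n k : ℕ} (hk : n ≤ k) : B n k = T (n + 1) :=
  Nat.card_congr (Equiv.subtypeEquivRight fun τ => ⟨fun h => h.1, fun h => ⟨h, by omega⟩⟩)

theorem Q_first' (n k : ℕ) : Qcount (n + 1) 1 (k + 1) =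
    Nat.card {σ : Equiv.Perm (Fin (n + 1)) // Av σ ∧ (σ 0 : ℕ) = k} := by
  refine Nat.card_congr (Equiv.subtypeEquivRight fun σ => ?_)
  rw [avoids_iff]
  refine and_congr_right fun _ => ⟨?_, ?_⟩
  · rintro ⟨i, hi, hk⟩
    have : i = 0 := Fin.ext (by simpa using hi)
    subst this
    omega
  · intro h
    exact ⟨0, by simp, by omega⟩

theorem B_zero_eq (n : ℕ) : B n 0 = Qcount (n + 1) 1 1 := by
  have := Q_first' n 0
  rw [zero_add] at this
  rw [this]
  exact Nat.card_congr (Equiv.subtypeEquivRight fun σ => by simp)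

theorem B_succ_eq (n k : ℕ) : B n (k + 1) = B n k + Qcount (n + 1) 1 (k + 2) := by
  classical
  have := Q_first' n (k + 1)
  rw [this]
  unfold B
  simp only [Nat.card_eq_fintype_card, Fintype.card_subtype]
  rw [← Finset.card_union_of_disjoint]
  · congr 1
    ext σ
    simp only [Finset.mem_union, Finset.mem_filter, Finset.mem_univ, true_and, ← and_or_left]
    refine and_congr_right fun _ => ?_
    omega
  · rw [Finset.disjoint_left]
    intro σ h1 h2
    simp only [Finset.mem_filter, Finset.mem_univ, true_and] at h1 h2
    omega

theorem T_zero : T 0 = 1 := by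
  unfold T
  rw [Nat.card_eq_one_iff_unique]
  exact ⟨⟨fun a b => Subtype.ext (Subsingleton.elim _ _)⟩, ⟨⟨1, fun i => i.elim0⟩⟩⟩

theorem T_one : T 1 = 1 := by
  unfold T
  rw [Nat.card_eq_one_iff_unique]
  refine ⟨⟨fun a b => Subtype.ext (Subsingleton.elim _ _)⟩, ⟨⟨1, fun i j l h => ?_⟩⟩⟩
  exact absurd h (by omega)

theorem B_zero (n : ℕ) : B n 0 = 1 := by
  induction n with
  | zero => rw [B_top le_rfl, T_one]
  | succ n ih =>
    rw [B_zero_eq]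
    exact (Q_first (n := n) (k := 0) (by omega)).trans ih

theorem B_rec {n k : ℕ} (hk : k ≤ n) : B (n + 1) (k + 1) = B (n + 1) k + B n (k + 1) := by
  rw [B_succ_eq, ← Q_first (n := n) (k := k + 1) (by omega)]

theorem B_closed (n : ℕ) : ∀ k ≤ n,
    B n (k + 1) + (n + 2 + k).choose k = (n + 2 + k).choose (k + 1) := by
  induction n with
  | zero =>
    intro k hk
    obtain rfl : k = 0 := by omega
    rw [B_top (by omega), T_one]
    decide
  | succ n ih =>
    have key : ∀ k ≤ n,
        B (n + 1) (k + 1) + (n + 1 + 2 + k).choose k = (n + 1 + 2 + k).choose (k + 1) := by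
      intro k
      induction k with
      | zero =>
        intro _
        have := ih 0 (by omega)
        rw [B_rec (by omega), B_zero]
        simp at this ⊢
        omega
      | succ k ihk =>
        intro hk
        have h1 := ihk (by omega)
        have h2 := ih (k + 1) hk
        rw [B_rec hk]
        have e1 := Nat.choose_succ_succ (n + 3 + k) k
        have e2 := Nat.choose_succ_succ (n + 3 + k) (k + 1)
        have a1 : n + 1 + 2 + (k + 1) = (n + 3 + k) + 1 := by omega
        have a2 : n + 2 + (k + 1) = n + 3 + k := by omega
        have a3 : n + 1 + 2 + k = n + 3 + k := by omega
        rw [a1]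
        rw [a2] at h2
        rw [a3] at h1
        simp only [Nat.succ_eq_add_one] at e1 e2
        omega
    intro k hk
    rcases Nat.lt_or_ge n k with h | h
    · obtain rfl : k = n + 1 := by omega
      have h1 := key n le_rfl
      rw [B_top le_rfl] at h1
      rw [B_top (by omega)]
      have e1 := Nat.choose_succ_succ (n + 3 + n) n
      have e2 := Nat.choose_succ_succ (n + 3 + n) (n + 1)
      have e3 : (n + 3 + n).choose (n + 1 + 1) = (n + 3 + n).choose (n + 1) :=
        Nat.choose_symm_of_eq_add (by omega)
      have a1 : n + 1 + 2 + (n + 1) = (n + 3 + n) + 1 := by omega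
      have a3 : n + 1 + 2 + n = n + 3 + n := by omega
      rw [a1]
      rw [a3] at h1
      simp only [Nat.succ_eq_add_one] at e1 e2
      omega
    · exact key k h

theorem T_eq (n : ℕ) : T n = catalan n := by
  cases n with
  | zero => simp [T_zero]
  | succ n =>
    have h := B_closed n n le_rfl
    rw [B_top (by omega)] at h
    have h2 := succ_mul_catalan_eq_centralBinom (n + 1)
    rw [Nat.centralBinom_eq_two_mul_choose] at h2
    have h3 := Nat.choose_succ_right_eq (n + 2 + n) n
    have a : 2 * (n + 1) = n + 2 + n := by omega
    have a' : n + 2 + n - n = n + 2 := by omega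
    rw [a] at h2
    rw [a'] at h3
    have : (n + 2) * T (n + 1) = (n + 2) * catalan (n + 1) := by
      rw [show n + 1 + 1 = n + 2 by rfl] at h2
      rw [h2]
      zify at *
      linear_combination (n + 2) * h + h3
    exact Nat.eq_of_mul_eq_mul_left (by omega) this

theorem av_front {n : ℕ} (k : Fin (n + 1)) (hk : n ≤ (k : ℕ) + 1) (τ : Equiv.Perm (Fin n))
    (h : Av τ) : Av (ins 0 k τ) := by
  cases n with
  | zero => exact av_ins h (fun i => i.elim0) (fun i => i.elim0) (fun i => i.elim0)
  | succ n => exact (av_ins_zero_iff k τ).2 ⟨h, by omega⟩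

theorem av_bot {n : ℕ} (p : Fin (n + 1)) (hp : n ≤ (p : ℕ) + 1) (τ : Equiv.Perm (Fin n))
    (h : Av τ) : Av (ins p 0 τ) := by
  refine av_ins h ?_ ?_ ?_
  · intro j l h1 h2; rw [Fin.lt_def] at h1; omega
  · intro i l _ _ _ _ h1; simp at h1
  · intro i l _ _ _ h1; simp at h1

theorem av_last {n : ℕ} (τ : Equiv.Perm (Fin n))
    (h : Av τ) : Av (ins (Fin.last n) (Fin.last n) τ) := by
  refine av_ins h ?_ ?_ ?_
  · intro j l _ h2; simp at h2; omega
  · intro i l _ _ h2; simp at h2; omega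
  · intro i l _ _ _ _ h2; simp at h2; omega

theorem exists_av (n : ℕ) : ∀ j k : Fin (n + 1), ∃ σ : Equiv.Perm (Fin (n + 1)), Av σ ∧ σ j = k := by
  induction n with
  | zero =>
    intro j k
    exact ⟨1, fun i j l h => absurd h (by omega), Fin.ext (by omega)⟩
  | succ n ih =>
    intro j k
    rcases Fin.eq_self_or_eq_succAbove (Fin.last _) j with rfl | ⟨j, rfl⟩
    · rcases Fin.eq_self_or_eq_succAbove (Fin.last _) k with rfl | ⟨k, rfl⟩
      · obtain ⟨σ, hσ, -⟩ := ih 0 0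
        exact ⟨_, av_last σ hσ, ins_self _ _ _⟩
      · obtain ⟨σ, hσ, e⟩ := ih (Fin.last n) k
        refine ⟨_, av_front (Fin.last _) (by simp) σ hσ, ?_⟩
        have := ins_succAbove 0 (Fin.last (n + 1)) σ (Fin.last n)
        rw [e] at this
        simpa using this
    · rcases Fin.eq_self_or_eq_succAbove (Fin.last _) k with rfl | ⟨k, rfl⟩
      · obtain ⟨σ, hσ, e⟩ := ih j (Fin.last n)
        refine ⟨_, av_bot (Fin.last _) (by simp) σ hσ, ?_⟩
        rw [ins_succAbove, e]
        simp
      · obtain ⟨σ, hσ, e⟩ := ih j k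
        exact ⟨_, av_last σ hσ, by rw [ins_succAbove, e]⟩

/-- Extreme values of `Q_n`: for `n ≥ 4`, the minimum value `1` is attained at `(1,1)`,
and the maximum value `C_{n-1}` is attained at the five positions
`(1,n), (1,n-1), (n-1,1), (n,1), (n,n)`. -/
theorem Qcount_extreme (n : ℕ) (hn : 4 ≤ n) :
    Qcount n 1 1 = 1 ∧
    (∀ j k : ℕ, 1 ≤ j → j ≤ n → 1 ≤ k → k ≤ n →
      1 ≤ Qcount n j k ∧ Qcount n j k ≤ catalan (n - 1)) ∧
    Qcount n 1 n = catalan (n - 1) ∧ Qcount n 1 (n - 1) = catalan (n - 1) ∧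
    Qcount n (n - 1) 1 = catalan (n - 1) ∧ Qcount n n 1 = catalan (n - 1) ∧
    Qcount n n n = catalan (n - 1) := by
  obtain ⟨m, rfl⟩ : ∃ m, n = m + 2 := ⟨n - 2, by omega⟩
  simp only [show m + 2 - 1 = m + 1 by omega]
  rw [← T_eq]
  refine ⟨?_, ?_, ?_, ?_, ?_, ?_, ?_⟩
  · exact (B_zero_eq (m + 1)).symm.trans (B_zero (m + 1))
  · intro j k hj hj' hk hk'
    obtain ⟨j, rfl⟩ : ∃ i, j = i + 1 := ⟨j - 1, by omega⟩
    obtain ⟨k, rfl⟩ : ∃ i, k = i + 1 := ⟨k - 1, by omega⟩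
    refine ⟨?_, Qcount_le (n := m + 1) ⟨j, by omega⟩ ⟨k, by omega⟩⟩
    obtain ⟨σ, hσ, e⟩ := exists_av (m + 1) ⟨j, by omega⟩ ⟨k, by omega⟩
    refine Nat.card_pos_iff.2 ⟨⟨⟨σ, (avoids_iff σ).2 hσ, ⟨j, by omega⟩, rfl, ?_⟩⟩, inferInstance⟩
    rw [e]
  · rw [← B_top (n := m) (k := m + 1) (by omega)]
    exact Q_first (by omega)
  · rw [← B_top (le_refl m)]
    exact Q_first (by omega)
  · exact Qcount_eq_T (n := m + 1) ⟨m, by omega⟩ 0 (av_bot _ (by simp))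
  · exact Qcount_eq_T (n := m + 1) (Fin.last _) 0 (av_bot _ (by simp))
  · exact Qcount_eq_T (n := m + 1) (Fin.last _) (Fin.last _) av_last
end

section
/- For all 1 ≤ j, k ≤ n with j + k ≤ n + 1, one has P_n(j,k) = b(n−k+1, j) · b(n−j+1, k); and for all 1 ≤ j, k ≤ n with j + k > n + 1, one has P_n(j,k) = b(j, n−k+1) · b(k, n−j+1). -/
open Filter Finset Real

/-- The ballot numbers `b(n,k) = ((n-k+1)/(n+k-1)) * C(n+k-1, n)`, as rationals. -/
def ballot (n k : ℕ) : ℚ :=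
  (((n : ℚ) - k + 1) / ((n : ℚ) + k - 1)) * (Nat.choose (n + k - 1) n : ℚ)

namespace PB

/-- Prepend the value `u` to `τ`, shifting the values `≥ u`. -/
def consFun {n : ℕ} (u : Fin (n + 1)) (τ : Equiv.Perm (Fin n)) : Fin (n + 1) → Fin (n + 1) :=
  Fin.cons u (fun i => u.succAbove (τ i))

lemma consFun_inj {n : ℕ} (u : Fin (n + 1)) (τ : Equiv.Perm (Fin n)) :
    Function.Injective (consFun u τ) := by
  unfold consFun
  rw [Fin.cons_injective_iff]
  refine ⟨?_, ?_⟩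
  · rintro ⟨i, hi⟩
    exact Fin.succAbove_ne u _ hi
  · intro a b h
    exact τ.injective (Fin.succAbove_right_injective h)

/-- `consFun` as a permutation. -/
noncomputable def consPerm {n : ℕ} (u : Fin (n + 1)) (τ : Equiv.Perm (Fin n)) :
    Equiv.Perm (Fin (n + 1)) :=
  Equiv.ofBijective (consFun u τ) (Finite.injective_iff_bijective.mp (consFun_inj u τ))

@[simp] lemma consPerm_zero {n : ℕ} (u : Fin (n + 1)) (τ : Equiv.Perm (Fin n)) :
    consPerm u τ 0 = u := by simp [consPerm, consFun]

@[simp] lemma consPerm_succ {n : ℕ} (u : Fin (n + 1)) (τ : Equiv.Perm (Fin n)) (i : Fin n) :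
    consPerm u τ i.succ = u.succAbove (τ i) := by simp [consPerm, consFun]

lemma consPerm_bij (n : ℕ) : Function.Bijective
    (fun p : Fin (n + 1) × Equiv.Perm (Fin n) => consPerm p.1 p.2) := by
  rw [Fintype.bijective_iff_injective_and_card]
  refine ⟨?_, ?_⟩
  · rintro ⟨u, τ⟩ ⟨v, ρ⟩ h
    have h' : consPerm u τ = consPerm v ρ := h
    have huv : u = v := by
      have := congrArg (fun e : Equiv.Perm (Fin (n + 1)) => e 0) h'
      simpa using this
    subst huv
    have : τ = ρ := by
      ext1 i
      have := congrArg (fun e : Equiv.Perm (Fin (n + 1)) => e i.succ) h'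
      simpa using this
    rw [this]
  · simp [Fintype.card_perm, Nat.factorial_succ]

lemma card_perm_succ (n : ℕ) (P : Equiv.Perm (Fin (n + 1)) → Prop) :
    Nat.card {σ // P σ} = ∑ u : Fin (n + 1), Nat.card {τ // P (consPerm u τ)} := by
  rw [← Nat.card_sigma]
  symm
  apply Nat.card_congr
  refine Equiv.trans ?_ ((Equiv.ofBijective _ (consPerm_bij n)).subtypeEquiv
    (p := fun p => P (consPerm p.1 p.2)) (q := P) (fun p => Iff.rfl))
  exact
    { toFun := fun x => ⟨(x.1, x.2.1), x.2.2⟩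
      invFun := fun y => ⟨y.1.1, ⟨y.1.2, y.2⟩⟩
      left_inv := fun _ => rfl
      right_inv := fun _ => rfl }

/-- avoids 123 -/
def Av {n : ℕ} (σ : Equiv.Perm (Fin n)) : Prop :=
  ∀ i j k, i < j → j < k → (σ i : ℕ) < σ j → ¬ (σ j : ℕ) < σ k

/-- values `≥ w` occur in decreasing order -/
def Dec {n : ℕ} (σ : Equiv.Perm (Fin n)) (w : ℕ) : Prop :=
  ∀ i j, i < j → w ≤ (σ i : ℕ) → (σ j : ℕ) < σ i

def Good {n : ℕ} (σ : Equiv.Perm (Fin n)) (w : ℕ) : Prop := Av σ ∧ Dec σ w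

/-- position `j` has value `k`, a left-to-right minimum -/
def Ltr {n : ℕ} (j k : ℕ) (σ : Equiv.Perm (Fin n)) : Prop :=
  ∃ i : Fin n, (i : ℕ) = j ∧ (σ i : ℕ) = k ∧ ∀ i' : Fin n, i' < i → k < σ i'

lemma sA_val {n : ℕ} (u : Fin (n + 1)) (t : Fin n) :
    ((u.succAbove t : Fin (n + 1)) : ℕ) = if (t : ℕ) < u then (t : ℕ) else t + 1 := by
  rw [Fin.succAbove]
  simp only [Fin.lt_def, Fin.val_castSucc]
  split_ifs <;> simp

lemma av_cons {n : ℕ} (u : Fin (n + 1)) (τ : Equiv.Perm (Fin n)) :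
    Av (consPerm u τ) ↔ Good τ u := by
  constructor
  · intro h
    refine ⟨?_, ?_⟩
    · intro i j k hij hjk h1 h2
      refine h i.succ j.succ k.succ (by simpa) (by simpa) ?_ ?_ <;>
      · simp only [consPerm_succ, sA_val]; split_ifs <;> omega
    · intro i j hij hu
      by_contra hc
      have hne : (τ i : ℕ) ≠ τ j := fun e => hij.ne (τ.injective (Fin.ext e))
      refine h 0 i.succ j.succ (Fin.succ_pos i) (by simpa) ?_ ?_ <;>
      · simp only [consPerm_succ, consPerm_zero, sA_val]; split_ifs <;> omega
  · rintro ⟨h1, h2⟩ i j k hij hjk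
    obtain ⟨j, rfl⟩ := Fin.exists_succ_eq.mpr (Fin.ne_zero_of_lt hij)
    obtain ⟨k, rfl⟩ := Fin.exists_succ_eq.mpr (Fin.ne_zero_of_lt hjk)
    have hjk' : j < k := by simpa using hjk
    refine Fin.cases ?_ ?_ i hij
    · intro _
      have := h2 j k hjk'
      simp only [consPerm_succ, consPerm_zero, sA_val]
      split_ifs <;> omega
    · intro i hi
      have := h1 i j k (by simpa using hi) hjk'
      simp only [consPerm_succ, sA_val]
      split_ifs <;> omega

lemma good_cons_lt {n : ℕ} (u : Fin (n + 1)) (τ : Equiv.Perm (Fin n)) (w : ℕ) (h : (u : ℕ) < w) :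
    Good (consPerm u τ) w ↔ Good τ u := by
  rw [Good, av_cons]
  refine ⟨fun h => h.1, fun hg => ⟨hg, ?_⟩⟩
  intro i j hij
  obtain ⟨j, rfl⟩ := Fin.exists_succ_eq.mpr (Fin.ne_zero_of_lt hij)
  refine Fin.cases ?_ ?_ i hij
  · intro _
    simp only [consPerm_zero]
    omega
  · intro i hi
    have := hg.2 i j (by simpa using hi)
    simp only [consPerm_succ, sA_val]
    split_ifs <;> omega

lemma good_cons_last {n : ℕ} (u : Fin (n + 1)) (τ : Equiv.Perm (Fin n)) (w : ℕ) (h : w ≤ (u : ℕ))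
    (hu : (u : ℕ) = n) :
    Good (consPerm u τ) w ↔ Good τ w := by
  rw [Good, av_cons]
  constructor
  · rintro ⟨h1, h2⟩
    refine ⟨h1.1, ?_⟩
    intro i j hij
    have := h2 i.succ j.succ (by simpa)
    have := (τ i).2
    have := (τ j).2
    simp only [consPerm_succ, sA_val] at *
    split_ifs at * <;> omega
  · rintro ⟨h1, h2⟩
    refine ⟨⟨h1, ?_⟩, ?_⟩
    · intro i j hij hh
      have := (τ i).2
      omega
    · intro i j hij
      obtain ⟨j, rfl⟩ := Fin.exists_succ_eq.mpr (Fin.ne_zero_of_lt hij)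
      refine Fin.cases ?_ ?_ i hij
      · intro _
        have := (τ j).2
        simp only [consPerm_succ, consPerm_zero, sA_val]
        split_ifs <;> omega
      · intro i hi
        have := h2 i j (by simpa using hi)
        have := (τ i).2
        have := (τ j).2
        simp only [consPerm_succ, sA_val]
        split_ifs <;> omega

lemma not_good_cons {n : ℕ} (u : Fin (n + 1)) (τ : Equiv.Perm (Fin n)) (w : ℕ) (h : w ≤ (u : ℕ))
    (hu : (u : ℕ) ≠ n) :
    ¬ Good (consPerm u τ) w := by
  rintro ⟨-, h2⟩
  have hn : (u : ℕ) < n := by have := u.2; omega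
  have := h2 0 (τ.symm ⟨u, hn⟩).succ (Fin.succ_pos _) (by simpa using h)
  simp [sA_val] at this

lemma ltr_cons_zero {n : ℕ} (u : Fin (n + 1)) (τ : Equiv.Perm (Fin n)) (k : ℕ) :
    Ltr 0 k (consPerm u τ) ↔ (u : ℕ) = k := by
  constructor
  · rintro ⟨i, hi, hk, -⟩
    have : i = 0 := Fin.ext hi
    subst this
    simpa using hk
  · intro h
    exact ⟨0, rfl, by simpa using h, fun i' hi' => absurd hi' (Fin.not_lt_zero _)⟩

lemma ltr_cons_succ {n : ℕ} (u : Fin (n + 1)) (τ : Equiv.Perm (Fin n)) (j k : ℕ) :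
    Ltr (j + 1) k (consPerm u τ) ↔ k < (u : ℕ) ∧ Ltr j k τ := by
  constructor
  · rintro ⟨i, hi, hk, hm⟩
    have hi0 : i ≠ 0 := by rintro rfl; simp at hi
    obtain ⟨i, rfl⟩ := Fin.exists_succ_eq.mpr hi0
    have h0 := hm 0 (Fin.succ_pos _)
    simp only [consPerm_zero] at h0
    refine ⟨h0, i, by simpa using hi, ?_, ?_⟩
    · simp only [consPerm_succ, sA_val] at hk
      split_ifs at hk <;> omega
    · intro i' hi'
      have := hm i'.succ (by simpa)
      simp only [consPerm_succ, sA_val] at this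
      split_ifs at this <;> omega
  · rintro ⟨h0, i, hi, hk, hm⟩
    refine ⟨i.succ, by simpa using hi, ?_, ?_⟩
    · simp only [consPerm_succ, sA_val]
      split_ifs <;> omega
    · intro i'
      refine Fin.cases ?_ ?_ i'
      · intro _; simpa using h0
      · intro i' hi'
        have := hm i' (by simpa using hi')
        simp only [consPerm_succ, sA_val]
        split_ifs <;> omega

noncomputable def c (n w : ℕ) : ℕ := Nat.card {σ : Equiv.Perm (Fin n) // Good σ w}

noncomputable def f (n j k w : ℕ) : ℕ :=
  Nat.card {σ : Equiv.Perm (Fin n) // Good σ w ∧ Ltr j k σ}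

lemma sum_aux (g : ℕ → ℕ) (n w : ℕ) (hw : w ≤ n + 1) :
    ∑ u ∈ range (n + 1), (if u < w then g u else if u = n then g w else 0)
      = ∑ u ∈ range (min w n + 1), g u := by
  rcases Nat.lt_or_ge n w with h | h
  · have : w = n + 1 := by omega
    subst this
    rw [min_eq_right (by omega)]
    apply sum_congr rfl
    intro u hu
    rw [if_pos (by simpa using hu)]
  · rw [min_eq_left h]
    rw [sum_range_succ, if_neg (by omega), if_pos rfl, sum_range_succ]
    congr 1
    rw [← sum_filter_add_sum_filter_not (range n) (fun u => u < w)]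
    rw [sum_filter, sum_filter]
    rw [sum_eq_zero (s := range n) (f := fun a => if ¬ a < w then _ else _), add_zero]
    · rw [← sum_filter]
      have : (range n).filter (fun u => u < w) = range w := by
        ext u; simp; omega
      rw [this]
      apply sum_congr rfl
      intro u hu
      rw [if_pos (by simpa using hu)]
    · intro u hu
      have := mem_range.mp hu
      split_ifs <;> first | rfl | omega

lemma c_succ (n w : ℕ) (hw : w ≤ n + 1) :
    c (n + 1) w = ∑ u ∈ range (min w n + 1), c n u := by
  rw [← sum_aux _ n w hw, c, card_perm_succ, ← Fin.sum_univ_eq_sum_range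
    (fun u => if u < w then c n u else if u = n then c n w else 0)]
  apply sum_congr rfl
  intro u _
  split_ifs with h1 h2
  · exact Nat.card_congr (Equiv.subtypeEquivRight fun τ => good_cons_lt u τ w h1)
  · exact Nat.card_congr (Equiv.subtypeEquivRight fun τ => good_cons_last u τ w (by omega) h2)
  · rw [Nat.card_eq_zero]
    left
    exact ⟨fun τ => not_good_cons u τ.1 w (by omega) h2 τ.2⟩

lemma f_zero (n k w : ℕ) (hk : k ≤ n) (hkw : k < w) : f (n + 1) 0 k w = c n k := by
  rw [f, card_perm_succ, Finset.sum_eq_single (⟨k, by omega⟩ : Fin (n + 1))]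
  · apply Nat.card_congr (Equiv.subtypeEquivRight fun τ => ?_)
    rw [ltr_cons_zero, good_cons_lt _ _ _ (by simpa using hkw)]
    simp
  · intro u _ hu
    rw [Nat.card_eq_zero]
    left
    refine ⟨fun τ => hu ?_⟩
    exact Fin.ext ((ltr_cons_zero _ _ _).mp τ.2.2)
  · simp

lemma f_succ (n j k w : ℕ) (hkn : k < n) (hkw : k < w) (hw : w ≤ n + 1) :
    f (n + 1) (j + 1) k w
      = ∑ v ∈ range (min (w - k - 1) (n - k - 1) + 1), f n j k (k + 1 + v) := by
  have h1 : ∑ v ∈ range (min (w - k - 1) (n - k - 1) + 1), f n j k (k + 1 + v)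
      = ∑ u ∈ range (min w n + 1), (if k < u then f n j k u else 0) := by
    have e : min w n + 1 = (k + 1) + (min (w - k - 1) (n - k - 1) + 1) := by omega
    rw [e, sum_range_add (n := k + 1), sum_eq_zero (s := range (k + 1)), zero_add]
    · apply sum_congr rfl
      intro v _
      rw [if_pos (by omega)]
    · intro v hv
      rw [if_neg (by have := mem_range.mp hv; omega)]
  rw [h1, ← sum_aux _ n w hw, f, card_perm_succ, ← Fin.sum_univ_eq_sum_range
    (fun u => if u < w then (if k < u then f n j k u else 0) else if u = n then
      (if k < w then f n j k w else 0) else 0)]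
  apply sum_congr rfl
  intro u _
  simp only [ltr_cons_succ]
  rw [if_pos hkw]
  split_ifs with h1 h2 h3
  · apply Nat.card_congr (Equiv.subtypeEquivRight fun τ => ?_)
    rw [good_cons_lt _ _ _ h1]
    tauto
  · rw [Nat.card_eq_zero]
    left
    exact ⟨fun τ => h2 τ.2.2.1⟩
  · apply Nat.card_congr (Equiv.subtypeEquivRight fun τ => ?_)
    rw [good_cons_last _ _ _ (by omega) h3]
    have : k < (u : ℕ) := by omega
    tauto
  · rw [Nat.card_eq_zero]
    left
    exact ⟨fun τ => not_good_cons u τ.1 w (by omega) h3 τ.2.1⟩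

/-- reflected binomial difference -/
def B (d j x : ℕ) : ℤ := ((j + x).choose j : ℤ) - ((j + x).choose (j + d + 1) : ℤ)

lemma B_step (d j x : ℕ) : B d (j + 1) (x + 1) = B d (j + 1) x + B d j (x + 1) := by
  unfold B
  have e1 : j + 1 + (x + 1) = (j + (x + 1)) + 1 := by ring
  have e2 : j + 1 + x = j + (x + 1) := by ring
  have e3 : j + 1 + d + 1 = (j + d + 1) + 1 := by ring
  rw [e1, e2, e3, Nat.choose_succ_succ, Nat.choose_succ_succ]
  push_cast
  ring

lemma B_zero_right (d j : ℕ) : B d j 0 = 1 := by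
  unfold B
  rw [Nat.choose_eq_zero_of_lt (by omega : j + 0 < j + d + 1)]
  simp

lemma B_zero_left (d x : ℕ) (h : x ≤ d) : B d 0 x = 1 := by
  unfold B
  rw [Nat.choose_eq_zero_of_lt (by omega : 0 + x < 0 + d + 1)]
  simp

lemma B_bdry (d j : ℕ) : B d j (d + j + 1) = 0 := by
  unfold B
  rw [Nat.choose_symm_of_eq_add (by omega : j + (d + j + 1) = j + (j + d + 1))]
  simp

lemma B_sum (d j m : ℕ) : ∑ u ∈ range (m + 1), B d j u = B d (j + 1) m := by
  induction m with
  | zero => simp [B_zero_right]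
  | succ m ih => rw [sum_range_succ, ih, B_step]

lemma B_sum' (d j x : ℕ) (h : x ≤ d + j + 1) :
    ∑ u ∈ range (min x (d + j) + 1), B d j u = B d (j + 1) x := by
  rw [B_sum]
  rcases Nat.lt_or_ge (d + j) x with h' | h'
  · have : x = d + j + 1 := by omega
    subst this
    rw [min_eq_right (by omega), B_step, B_bdry, add_zero]
  · rw [min_eq_left h']

lemma c_eq (n : ℕ) : ∀ w ≤ n, (c n w : ℤ) = B 0 n w := by
  induction n with
  | zero =>
    intro w hw
    have : w = 0 := by omega
    subst this
    rw [B_zero_right, c]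
    have : Nat.card {σ : Equiv.Perm (Fin 0) // Good σ 0} = 1 := by
      rw [Nat.card_eq_one_iff_unique]
      refine ⟨inferInstance, ⟨⟨1, ?_, ?_⟩⟩⟩
      · intro i; exact i.elim0
      · intro i; exact i.elim0
    rw [this]; rfl
  | succ n ih =>
    intro w hw
    rw [c_succ n w hw, ← B_sum' 0 n w (by omega)]
    push_cast
    rw [zero_add]
    apply sum_congr rfl
    intro u hu
    have := mem_range.mp hu
    exact ih u (by omega)

lemma f_eq (r k : ℕ) (hk : k ≤ r) (j : ℕ) : ∀ w, k < w → w ≤ r + 1 + j →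
    (f (r + 1 + j) j k w : ℤ) = c r k * B (r - k) j (w - k - 1) := by
  induction j with
  | zero =>
    intro w h1 h2
    rw [B_zero_left _ _ (by omega), mul_one]
    exact_mod_cast f_zero r k w hk h1
  | succ j ih =>
    intro w h1 h2
    have := f_succ (r + 1 + j) j k w (by omega) h1 (by omega)
    rw [show r + 1 + (j + 1) = r + 1 + j + 1 by ring, this, ← B_sum' _ _ _ (by omega), mul_sum]
    rw [show r + 1 + j - k - 1 = r - k + j by omega]
    push_cast
    apply sum_congr rfl
    intro u hu
    have := mem_range.mp hu
    rw [ih _ (by omega) (by omega)]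
    rw [show k + 1 + u - k - 1 = u by omega]

lemma avoids_iff {n : ℕ} (σ : Equiv.Perm (Fin n)) : Avoids σ pattern123 ↔ Av σ := by
  unfold Avoids ContainsPattern Av pattern123
  constructor
  · intro h i j k hij hjk h1 h2
    apply h
    refine ⟨![i, j, k], ?_, ?_⟩
    · rw [Fin.strictMono_iff_lt_succ]
      intro a
      fin_cases a <;> simpa
    · intro a b
      rw [Fin.lt_def]
      fin_cases a <;> fin_cases b <;> simp <;> omega
  · rintro h ⟨g, hg, hp⟩
    refine h (g 0) (g 1) (g 2) (hg (by decide)) (hg (by decide)) ?_ ?_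
    · exact (hp 0 1).mpr (by decide)
    · exact (hp 1 2).mpr (by decide)

lemma ltr_of_av {n : ℕ} (σ : Equiv.Perm (Fin n)) (h : Av σ) (i : Fin n)
    (hi : (i : ℕ) + (σ i : ℕ) + 1 ≤ n) (i' : Fin n) (hi' : i' < i) : (σ i : ℕ) < σ i' := by
  by_contra hc
  have hne : (σ i' : ℕ) ≠ σ i := fun e => hi'.ne (σ.injective (Fin.ext e))
  have hsub : (Finset.Ioi (σ i)).map σ.symm.toEmbedding ⊆ (Finset.Iio i).erase i' := by
    intro x hx
    simp only [Finset.mem_map, Finset.mem_Ioi, Equiv.toEmbedding_apply] at hx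
    obtain ⟨y, hy, rfl⟩ := hx
    have hy' : (σ i : ℕ) < y := hy
    rw [Finset.mem_erase, Finset.mem_Iio]
    refine ⟨?_, ?_⟩
    · rintro rfl
      simp at hc hne
      omega
    · by_contra hx
      rcases eq_or_lt_of_le (not_lt.mp hx) with e | e
      · rw [e] at hy'; simp at hy'
      · exact h i' i _ hi' e (by omega) (by simpa using hy')
  have := Finset.card_le_card hsub
  rw [Finset.card_map, Finset.card_erase_of_mem (by simpa using hi')] at this
  simp at this
  have h2 : (i' : ℕ) < i := hi'
  omega

lemma Pcount_eq_f (n j k : ℕ) (h : j + k + 1 ≤ n) : Pcount n (j + 1) (k + 1) = f n j k n := by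
  unfold Pcount f
  apply Nat.card_congr (Equiv.subtypeEquivRight fun σ => ?_)
  rw [avoids_iff]
  constructor
  · rintro ⟨h1, i, hi, hk⟩
    refine ⟨⟨h1, ?_⟩, i, by omega, by omega, ?_⟩
    · intro a b _ hh
      have := (σ a).2
      omega
    · intro i' hi'
      have := ltr_of_av σ h1 i (by omega) i' hi'
      omega
  · rintro ⟨h1, i, hi, hk, -⟩
    exact ⟨h1.1, i, by omega, by omega⟩

lemma ballot_eq_B (d j : ℕ) : ballot (d + 1 + j) (j + 1) = (B d j (d + j) : ℚ) := by
  unfold ballot B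
  rw [show d + 1 + j + (j + 1) - 1 = 2 * j + d + 1 by omega]
  rw [show j + (d + j) = 2 * j + d by omega]
  have h1 : (2 * j + d + 1).choose (d + 1 + j) * (d + 1 + j)
      = (2 * j + d + 1) * (2 * j + d).choose j := by
    have := Nat.add_one_mul_choose_eq (2 * j + d) (d + j)
    rw [Nat.choose_symm_of_eq_add (by omega : 2 * j + d = (d + j) + j)] at this
    rw [show d + 1 + j = d + j + 1 by omega, this]
  have h2 : (2 * j + d + 1).choose (d + 1 + j)
      = (2 * j + d).choose j + (2 * j + d).choose (j + d + 1) := by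
    rw [show d + 1 + j = d + j + 1 by omega, Nat.choose_succ_succ,
      Nat.choose_symm_of_eq_add (by omega : 2 * j + d = (d + j) + j),
      show (d + j).succ = j + d + 1 by omega]
  have h1' : ((2 * j + d + 1).choose (d + 1 + j) : ℚ) * (d + 1 + j)
      = (2 * j + d + 1) * (2 * j + d).choose j := by exact_mod_cast h1
  have h2' : ((2 * j + d + 1).choose (d + 1 + j) : ℚ)
      = (2 * j + d).choose j + (2 * j + d).choose (j + d + 1) := by exact_mod_cast h2
  have h3 : ((2 * j + d).choose (j + d + 1) : ℚ)
      = (2 * j + d + 1).choose (d + 1 + j) - (2 * j + d).choose j := by linarith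
  push_cast
  rw [h3]
  have hp : ((2 : ℚ) * j + d + 1) ≠ 0 := by positivity
  have e : ((d : ℚ) + 1 + j + (j + 1) - 1) = 2 * j + d + 1 := by ring
  rw [e, div_mul_eq_mul_div, div_eq_iff hp]
  linear_combination (2 : ℚ) * h1'

lemma main1 (n j k : ℕ) (h : j + k + 1 ≤ n) :
    (Pcount n (j + 1) (k + 1) : ℚ) = ballot (n - k) (j + 1) * ballot (n - j) (k + 1) := by
  obtain ⟨d, rfl⟩ : ∃ d, n = (d + k) + 1 + j := ⟨n - 1 - j - k, by omega⟩
  have h1 := f_eq (d + k) k (by omega) j (d + k + 1 + j) (by omega) le_rfl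
  rw [← Pcount_eq_f _ _ _ h, c_eq _ _ (by omega)] at h1
  rw [show d + k + 1 + j - k = d + 1 + j by omega, show d + k + 1 + j - j = d + 1 + k by omega,
    ballot_eq_B, ballot_eq_B]
  have h2 : B 0 (d + k) k = B d k (d + k) := by
    unfold B
    rw [show d + k + k = k + (d + k) by omega,
      Nat.choose_symm_of_eq_add (by omega : k + (d + k) = (d + k) + k),
      show d + k + 0 + 1 = k + d + 1 by omega]
  rw [h2, show d + k - k = d by omega, show d + k + 1 + j - k - 1 = d + j by omega] at h1
  have h3 : (Pcount (d + k + 1 + j) (j + 1) (k + 1) : ℚ) = B d k (d + k) * B d j (d + j) := by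
    exact_mod_cast h1
  rw [h3, mul_comm]

lemma av_rev {n : ℕ} (σ : Equiv.Perm (Fin n)) (h : Av σ) :
    Av ((Fin.revPerm.trans σ).trans Fin.revPerm) := by
  intro i j k hij hjk h1 h2
  simp only [Equiv.trans_apply, Fin.revPerm_apply, Fin.val_rev] at h1 h2
  exact h k.rev j.rev i.rev (by simpa) (by simpa) (by omega) (by omega)

lemma Pcount_symm (n j k : ℕ) (hjn : j ≤ n) (hkn : k ≤ n) (hj : 1 ≤ j) (hk : 1 ≤ k) :
    Pcount n j k = Pcount n (n + 1 - j) (n + 1 - k) := by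
  unfold Pcount
  have hinv : ∀ σ : Equiv.Perm (Fin n), (Fin.revPerm.trans
      ((Fin.revPerm.trans σ).trans Fin.revPerm)).trans Fin.revPerm = σ := by
    intro σ; ext i; simp
  refine Nat.card_congr (Equiv.subtypeEquiv
    { toFun := fun σ => (Fin.revPerm.trans σ).trans Fin.revPerm
      invFun := fun σ => (Fin.revPerm.trans σ).trans Fin.revPerm
      left_inv := hinv
      right_inv := hinv } fun σ => ?_)
  simp only [avoids_iff, Equiv.coe_fn_mk]
  constructor
  · rintro ⟨h, i, hi, hki⟩
    refine ⟨av_rev σ h, i.rev, ?_, ?_⟩ <;> simp <;> omega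
  · rintro ⟨h, i, hi, hki⟩
    refine ⟨by rw [← hinv σ]; exact av_rev _ h, i.rev, ?_, ?_⟩ <;>
      simp at hki ⊢ <;> omega

end PB

/-- Explicit product formula for `P_n(j,k)` in terms of ballot numbers. -/
theorem Pcount_eq_ballot_mul_ballot (n j k : ℕ)
    (hj1 : 1 ≤ j) (hjn : j ≤ n) (hk1 : 1 ≤ k) (hkn : k ≤ n) :
    (j + k ≤ n + 1 →
      (Pcount n j k : ℚ) = ballot (n - k + 1) j * ballot (n - j + 1) k) ∧
    (n + 1 < j + k →
      (Pcount n j k : ℚ) = ballot j (n - k + 1) * ballot k (n - j + 1)) := by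
  constructor
  · intro h
    have := PB.main1 n (j - 1) (k - 1) (by omega)
    rw [show j - 1 + 1 = j by omega, show k - 1 + 1 = k by omega,
      show n - (k - 1) = n - k + 1 by omega, show n - (j - 1) = n - j + 1 by omega] at this
    exact this
  · intro h
    rw [PB.Pcount_symm n j k hjn hkn hj1 hk1]
    have := PB.main1 n (n - j) (n - k) (by omega)
    rw [show n - (n - k) = k by omega, show n - (n - j) = j by omega] at this
    rw [show n + 1 - j = n - j + 1 by omega, show n + 1 - k = n - k + 1 by omega, this, mul_comm]
end

section
/- For all 1 ≤ j, k ≤ n, one has Q_n(j,k) = Σ_r b(n−j+1, k−r) · b(n−k+1, j−r) · C_r, where the sum is over all integers r with max{0, j+k−n−1} ≤ r ≤ min{j,k} − 1. -/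
open Filter Finset Real

/-- Entry at position `j` of the 132-avoiding permutation encoded by a tree. -/
def tval : BinaryTree Unit → ℕ → ℕ
  | .nil, _ => 0
  | .node _ l r, j =>
    if j < l.numNodes then tval l j + r.numNodes
    else if j = l.numNodes then l.numNodes + r.numNodes
    else tval r (j - l.numNodes - 1)

/-- Size of the left subtree of the node at (inorder) position `j`. -/
def tls : BinaryTree Unit → ℕ → ℕ
  | .nil, _ => 0
  | .node _ l r, j =>
    if j < l.numNodes then tls l j
    else if j = l.numNodes then l.numNodes
    else tls r (j - l.numNodes - 1)

/-- `f` restricted to `[0,n)` is a 132-avoiding permutation of `[0,n)`. -/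
def Good (n : ℕ) (f : ℕ → ℕ) : Prop :=
  (∀ j < n, f j < n) ∧ (∀ i < n, ∀ j < n, f i = f j → i = j) ∧
    ∀ i j k, i < j → j < k → k < n → f i < f k → f k < f j → False

theorem tval_lt (t : BinaryTree Unit) : ∀ j < t.numNodes, tval t j < t.numNodes := by
  induction t with
  | nil => intro j hj; simp [BinaryTree.numNodes] at hj
  | node a l r ihl ihr =>
    intro j hj
    simp only [BinaryTree.numNodes] at hj
    simp only [tval, BinaryTree.numNodes]
    split_ifs with h1 h2
    · have := ihl j h1; omega
    · omega
    · have := ihr (j - l.numNodes - 1) (by omega); omega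

theorem tls_bounds (t : BinaryTree Unit) : ∀ j < t.numNodes,
    tls t j ≤ j ∧ tls t j ≤ tval t j ∧ j + tval t j < t.numNodes + tls t j := by
  induction t with
  | nil => intro j hj; simp [BinaryTree.numNodes] at hj
  | node a l r ihl ihr =>
    intro j hj
    simp only [BinaryTree.numNodes] at hj
    simp only [tval, tls, BinaryTree.numNodes]
    split_ifs with h1 h2
    · have := ihl j h1; omega
    · omega
    · have := ihr (j - l.numNodes - 1) (by omega); omega

theorem tval_good (t : BinaryTree Unit) : Good t.numNodes (tval t) := by
  induction t with
  | nil => simp [Good, BinaryTree.numNodes]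
  | node a l r ihl ihr =>
    refine ⟨tval_lt _, ?_, ?_⟩
    · intro i hi j hj h
      have := tval_lt l i
      have := tval_lt l j
      have := tval_lt r (i - l.numNodes - 1)
      have := tval_lt r (j - l.numNodes - 1)
      have := ihl.2.1 i
      have hl := fun h1 h2 => ihl.2.1 i h1 j h2
      have hr := fun h1 h2 => ihr.2.1 (i - l.numNodes - 1) h1 (j - l.numNodes - 1) h2
      simp only [tval, BinaryTree.numNodes] at *
      grind
    · intro i j k hij hjk hk h1 h2
      have := tval_lt l i
      have := tval_lt l j
      have := tval_lt l k
      have := tval_lt r (i - l.numNodes - 1)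
      have := tval_lt r (j - l.numNodes - 1)
      have := tval_lt r (k - l.numNodes - 1)
      have hl := ihl.2.2 i j k hij hjk
      have hr := ihr.2.2 (i - l.numNodes - 1) (j - l.numNodes - 1) (k - l.numNodes - 1)
      simp only [tval, BinaryTree.numNodes] at *
      grind

theorem tval_inj (t : BinaryTree Unit) : ∀ s : BinaryTree Unit, t.numNodes = s.numNodes →
    (∀ j < t.numNodes, tval t j = tval s j) → t = s := by
  induction t with
  | nil =>
    intro s hs _
    cases s with
    | nil => rfl
    | node => simp [BinaryTree.numNodes] at hs
  | node a l r ihl ihr =>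
    intro s hs h
    cases s with
    | nil => simp [BinaryTree.numNodes] at hs
    | node b l' r' =>
      simp only [tval, BinaryTree.numNodes] at hs h
      have hll : l.numNodes = l'.numNodes := by
        have h0 := h l.numNodes (by omega)
        have := tval_lt l' l.numNodes
        have := tval_lt r' (l.numNodes - l'.numNodes - 1)
        grind
      have hrr : r.numNodes = r'.numNodes := by omega
      have e1 : l = l' := by
        refine ihl l' hll fun j hj => ?_
        have h0 := h j (by omega)
        grind
      have e2 : r = r' := by
        refine ihr r' hrr fun j hj => ?_
        have h0 := h (l.numNodes + 1 + j) (by omega)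
        have e : l.numNodes + 1 + j - l.numNodes - 1 = j := by omega
        have e' : l.numNodes + 1 + j - l'.numNodes - 1 = j := by omega
        rw [e, e'] at h0
        grind
      subst e1 e2
      rfl

theorem good_surj (n : ℕ) : ∀ f : ℕ → ℕ, Good n f →
    ∃ t : BinaryTree Unit, t.numNodes = n ∧ ∀ j < n, tval t j = f j := by
  induction n using Nat.strong_induction_on with
  | _ n ih =>
    intro f hf
    rcases n with _ | n
    · exact ⟨.nil, rfl, by simp⟩
    obtain ⟨h1, h2, h3⟩ := hf
    -- position of the maximum
    obtain ⟨m, hm, hfm⟩ : ∃ m < n + 1, f m = n := by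
      have := Finset.surj_on_of_inj_on_of_card_le (s := Finset.range (n+1)) (t := Finset.range (n+1))
        (fun a _ => f a) (by simpa using h1)
        (fun a b ha hb hab => h2 a (by simpa using ha) b (by simpa using hb) hab) le_rfl n (by simp)
      obtain ⟨m, hm, h⟩ := this
      exact ⟨m, by simpa using hm, h.symm⟩
    have hlr : ∀ i k, i < m → m < k → k < n + 1 → f k < f i := by
      intro i k hi hk hkn
      by_contra hc
      have : f i ≠ f k := fun h => by have := h2 i (by omega) k hkn h; omega
      have : f k ≠ n := fun h => by have := h2 k hkn m hm (by omega); omega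
      have := h1 k hkn
      exact h3 i m k hi hk hkn (by omega) (by omega)
    have hL : ∀ i < m, n - m ≤ f i := by
      intro i hi
      have := Finset.card_le_card_of_injOn (s := Finset.Ioc m n) (t := Finset.range (f i)) f
        (fun k hk => by
          simp only [Finset.coe_Ioc, Set.mem_Ioc] at hk
          simpa using hlr i k hi (by omega) (by omega))
        (fun a ha b hb hab => h2 a (by simp at ha; omega) b (by simp at hb; omega) hab)
      simpa using this
    have hR : ∀ k, m < k → k < n + 1 → f k < n - m := by
      intro k hk hkn
      have := Finset.card_le_card_of_injOn (s := Finset.range m) (t := Finset.Ioo (f k) n) f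
        (fun i hi => by
          have hi : i < m := by simpa using hi
          have := hlr i k hi hk hkn
          have := h1 i (by omega)
          have : f i ≠ n := fun h => by have := h2 i (by omega) m hm (by omega); omega
          simp; omega)
        (fun a ha b hb hab => h2 a (by simp at ha; omega) b (by simp at hb; omega) hab)
      have h4 : f k ≠ n := fun h => by have := h2 k hkn m hm (by omega); omega
      have := h1 k hkn
      simp at this
      have h5 := this
      simp only [Finset.card_range, Nat.card_Ioo] at *
      omega
    obtain ⟨l, hl, hl'⟩ := ih m hm (fun i => f i - (n - m)) (by
      refine ⟨?_, ?_, ?_⟩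
      · intro i hi
        beta_reduce at *
        have := hL i hi
        have := h1 i (by omega)
        have : f i ≠ n := fun h => by have := h2 i (by omega) m hm (by omega); omega
        omega
      · intro i hi j hj h
        beta_reduce at *
        have := hL i hi
        have := hL j hj
        exact h2 i (by omega) j (by omega) (by omega)
      · intro i j k hij hjk hk h h'
        beta_reduce at *
        exact h3 i j k hij hjk (by omega) (by omega) (by omega))
    obtain ⟨r, hr, hr'⟩ := ih (n - m) (by omega) (fun i => f (m + 1 + i)) (by
      refine ⟨?_, ?_, ?_⟩
      · intro i hi
        exact hR _ (by omega) (by omega)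
      · intro i hi j hj h
        have := h2 _ (by omega) _ (by omega) h
        omega
      · intro i j k hij hjk hk h h'
        exact h3 _ _ _ (by omega) (by omega) (by omega) h h')
    refine ⟨.node () l r, by simp [BinaryTree.numNodes]; omega, ?_⟩
    intro j hj
    simp only [tval, hl, hr]
    split_ifs with c1 c2
    · have := hL j c1
      rw [hl' j c1]; omega
    · subst c2; omega
    · rw [hr' _ (by omega)]
      congr 1; omega

theorem avoids132_iff {n : ℕ} (σ : Equiv.Perm (Fin n)) :
    Avoids σ pattern132 ↔ ∀ i j k : Fin n, i < j → j < k → σ i < σ k → σ k < σ j → False := by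
  unfold Avoids ContainsPattern
  constructor
  · intro h i j k hij hjk h1 h2
    apply h
    refine ⟨![i, j, k], ?_, ?_⟩
    · intro a b hab
      have h3 := hij.trans hjk
      fin_cases a <;> fin_cases b <;> simp_all
    · have h3 := h1.trans h2
      intro a b
      fin_cases a <;> fin_cases b <;>
        simp [pattern132, Equiv.swap_apply_def, h1, h2, h3, h1.le, h2.le, h3.le]
  · rintro h ⟨f, hf, hp⟩
    refine h (f 0) (f 1) (f 2) (hf (by decide)) (hf (by decide)) ?_ ?_
    · rw [hp]; decide
    · rw [hp]; decide

/-- The permutation encoded by a tree. -/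
noncomputable def tperm (n : ℕ) (t : BinaryTree Unit) (h : t.numNodes = n) :
    Equiv.Perm (Fin n) :=
  Equiv.ofBijective (fun i : Fin n => (⟨tval t i, by
      have := tval_lt t i (by omega); omega⟩ : Fin n)) (by
    apply Finite.injective_iff_bijective.1
    intro i j hij
    simp only [Fin.mk.injEq] at hij
    exact Fin.ext ((tval_good t).2.1 i (by omega) j (by omega) hij))

theorem tperm_val (n : ℕ) (t : BinaryTree Unit) (h : t.numNodes = n) (i : Fin n) :
    (tperm n t h i : ℕ) = tval t i := rfl

theorem Qcount_eq_trees (n j k : ℕ) (hj : j < n) :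
    Qcount n (j + 1) (k + 1) =
      ((BinaryTree.treesOfNumNodesEq n).filter (fun t => tval t j = k)).card := by
  unfold Qcount
  rw [← Nat.card_eq_finsetCard]
  symm
  refine Nat.card_eq_of_bijective (fun t => ⟨tperm n t.1 (by
      have := t.2
      rw [Finset.mem_filter, BinaryTree.mem_treesOfNumNodesEq] at this
      exact this.1), ?_, ?_⟩) ⟨?_, ?_⟩
  · have := t.2
    rw [Finset.mem_filter, BinaryTree.mem_treesOfNumNodesEq] at this
    rw [avoids132_iff]
    intro a b c hab hbc h1 h2
    rw [Fin.lt_def, tperm_val, tperm_val] at h1 h2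
    exact (tval_good t.1).2.2 a b c hab hbc (by omega) h1 h2
  · have := t.2
    rw [Finset.mem_filter, BinaryTree.mem_treesOfNumNodesEq] at this
    exact ⟨⟨j, hj⟩, rfl, by rw [tperm_val]; simp [this.2]⟩
  · rintro ⟨t, ht⟩ ⟨s, hs⟩ h
    rw [Finset.mem_filter, BinaryTree.mem_treesOfNumNodesEq] at ht hs
    simp only [Subtype.mk.injEq] at h ⊢
    refine tval_inj t s (by omega) fun i hi => ?_
    have := congrArg (fun σ : Equiv.Perm (Fin n) => ((σ ⟨i, by omega⟩ : Fin n) : ℕ)) h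
    simpa only [tperm_val] using this
  · rintro ⟨σ, hσ, i, hi, hk⟩
    rw [avoids132_iff] at hσ
    obtain ⟨t, ht, ht'⟩ := good_surj n (fun i => if h : i < n then (σ ⟨i, h⟩ : ℕ) else 0) (by
      refine ⟨?_, ?_, ?_⟩
      · intro a ha
        simp [ha]
      · intro a ha b hb hab
        simp only [ha, hb, dite_true] at hab
        have := σ.injective (Fin.ext hab)
        simpa using this
      · intro a b c hab hbc hc h1 h2
        have hb : b < n := by omega
        have ha : a < n := by omega
        simp only [ha, hb, hc, dite_true] at h1 h2
        exact hσ ⟨a, ha⟩ ⟨b, hb⟩ ⟨c, hc⟩ hab hbc h1 h2)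
    refine ⟨⟨t, ?_⟩, ?_⟩
    · rw [Finset.mem_filter, BinaryTree.mem_treesOfNumNodesEq]
      refine ⟨ht, ?_⟩
      rw [ht' j hj]
      have : i = ⟨j, hj⟩ := Fin.ext (by simp; omega)
      subst this
      simp [hj]; omega
    · apply Subtype.ext
      apply Equiv.ext
      intro a
      apply Fin.ext
      simp only [tperm_val]
      rw [ht' a a.2]
      simp

/-- Trees with `n` nodes whose `j`-th node has value `k` and left subtree of size `r`. -/
def Wcount (n j k r : ℕ) : ℕ :=
  ((BinaryTree.treesOfNumNodesEq n).filter (fun t => tval t j = k ∧ tls t j = r)).card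

theorem Wcount_zero (n j k r : ℕ) (hj : j < n) (h : ¬ (r ≤ j ∧ r ≤ k ∧ j + k < n + r)) :
    Wcount n j k r = 0 := by
  rw [Wcount, Finset.card_eq_zero, Finset.filter_eq_empty_iff]
  rintro t ht ⟨h1, h2⟩
  rw [BinaryTree.mem_treesOfNumNodesEq] at ht
  have := tls_bounds t j (by omega)
  omega

theorem card_filter_pairwise (a b : Finset (BinaryTree Unit)) (P : BinaryTree Unit → Prop)
    [DecidablePred P] : ((BinaryTree.pairwiseNode a b).filter P).card =
      ((a ×ˢ b).filter (fun x => P (.node () x.1 x.2))).card := by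
  rw [BinaryTree.pairwiseNode, Finset.filter_map, Finset.card_map]
  rfl

theorem mem_pairwise (a b : Finset (BinaryTree Unit)) (t : BinaryTree Unit) :
    t ∈ BinaryTree.pairwiseNode a b ↔ ∃ l, l ∈ a ∧ ∃ s, s ∈ b ∧ t = .node () l s := by
  rw [BinaryTree.pairwiseNode, Finset.mem_map]
  constructor
  · rintro ⟨x, hx, rfl⟩
    rw [Finset.mem_product] at hx
    exact ⟨x.1, hx.1, x.2, hx.2, rfl⟩
  · rintro ⟨l, hl, s, hs, rfl⟩
    exact ⟨(l, s), Finset.mem_product.2 ⟨hl, hs⟩, rfl⟩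

theorem Wcount_succ (n j k r : ℕ) :
    Wcount (n + 1) j k r = ∑ p ∈ Finset.HasAntidiagonal.antidiagonal n,
      if j < p.1 then (if p.2 ≤ k then Wcount p.1 j (k - p.2) r * catalan p.2 else 0)
      else if j = p.1 then (if k = n ∧ r = p.1 then catalan p.1 * catalan p.2 else 0)
      else catalan p.1 * Wcount p.2 (j - p.1 - 1) k r := by
  rw [Wcount, BinaryTree.treesOfNumNodesEq_succ, Finset.filter_biUnion, Finset.card_biUnion]
  · apply Finset.sum_congr rfl
    rintro ⟨a, b⟩ hab
    rw [Finset.HasAntidiagonal.mem_antidiagonal] at hab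
    simp only at hab ⊢
    rw [card_filter_pairwise]
    simp only [← BinaryTree.treesOfNumNodesEq_card_eq_catalan, Wcount]
    split_ifs with h1 h2 h3 h4
    · rw [← Finset.card_product]
      congr 1
      ext ⟨l, s⟩
      simp only [Finset.mem_filter, Finset.mem_product, BinaryTree.mem_treesOfNumNodesEq,
        Finset.notMem_empty]
      simp only [tval, tls]
      grind
    · rw [Finset.card_eq_zero]
      ext ⟨l, s⟩
      simp only [Finset.mem_filter, Finset.mem_product, BinaryTree.mem_treesOfNumNodesEq,
        Finset.notMem_empty]
      simp only [tval, tls]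
      grind
    · rw [← Finset.card_product]
      congr 1
      ext ⟨l, s⟩
      simp only [Finset.mem_filter, Finset.mem_product, BinaryTree.mem_treesOfNumNodesEq,
        Finset.notMem_empty]
      simp only [tval, tls]
      grind
    · rw [Finset.card_eq_zero]
      ext ⟨l, s⟩
      simp only [Finset.mem_filter, Finset.mem_product, BinaryTree.mem_treesOfNumNodesEq,
        Finset.notMem_empty]
      simp only [tval, tls]
      grind
    · rw [← Finset.card_product]
      congr 1
      ext ⟨l, s⟩
      simp only [Finset.mem_filter, Finset.mem_product, BinaryTree.mem_treesOfNumNodesEq,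
        Finset.notMem_empty]
      simp only [tval, tls]
      grind
  · intro p hp q hq hpq
    rw [Function.onFun, Finset.disjoint_left]
    intro t h1 h2
    apply hpq
    simp only [Finset.mem_filter, mem_pairwise,
      BinaryTree.mem_treesOfNumNodesEq] at h1 h2
    obtain ⟨⟨l, hl, s, hs, rfl⟩, _⟩ := h1
    obtain ⟨⟨l', hl', s', hs', h⟩, _⟩ := h2
    simp only [BinaryTree.node.injEq] at h
    obtain ⟨_, e1, e2⟩ := h
    apply Prod.ext
    · rw [← hl, ← hl', e1]
    · rw [← hs, ← hs', e2]

/-- Coefficient of `x^d` in `C(x)^(e+1)`. -/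
noncomputable def Tc (e d : ℕ) : ℕ :=
  PowerSeries.coeff d (PowerSeries.catalanSeries ^ (e + 1))

theorem Tc_zero_left (d : ℕ) : Tc 0 d = catalan d := by simp [Tc]

theorem Tc_zero_right (e : ℕ) : Tc e 0 = 1 := by
  simp [Tc]

theorem Tc_conv (e d : ℕ) :
    Tc (e + 1) d = ∑ p ∈ Finset.HasAntidiagonal.antidiagonal d, catalan p.1 * Tc e p.2 := by
  rw [Tc, pow_succ', PowerSeries.coeff_mul]
  simp [Tc]

theorem Tc_step (e d : ℕ) : Tc (e + 1) (d + 1) = Tc e (d + 1) + Tc (e + 2) d := by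
  unfold Tc
  have h : PowerSeries.catalanSeries ^ (e + 1 + 1) = PowerSeries.catalanSeries ^ (e + 1)
      + PowerSeries.catalanSeries ^ (e + 2 + 1) * PowerSeries.X := by
    conv_lhs => rw [pow_succ, ← PowerSeries.catalanSeries_sq_mul_X_add_one]
    conv_lhs => rw [PowerSeries.catalanSeries_sq_mul_X_add_one]
    conv_lhs => rw [pow_succ]
    nth_rw 2 [← PowerSeries.catalanSeries_sq_mul_X_add_one]
    ring
  rw [h, map_add, PowerSeries.coeff_succ_mul_X]

theorem Tc_step0 (d : ℕ) : Tc 0 (d + 1) = Tc 1 d := by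
  unfold Tc
  have h : PowerSeries.catalanSeries ^ (0 + 1) = 
      PowerSeries.catalanSeries ^ (1 + 1) * PowerSeries.X + 1 := by
    rw [PowerSeries.catalanSeries_sq_mul_X_add_one]; simp
  rw [h, map_add, PowerSeries.coeff_succ_mul_X]
  simp [PowerSeries.coeff_one]

theorem Tc_closed (d : ℕ) : ∀ e : ℕ,
    ((2 * d + e + 1 : ℕ) : ℚ) * Tc e d = ((e + 1 : ℕ) : ℚ) * Nat.choose (2 * d + e + 1) d := by
  induction d with
  | zero => intro e; simp [Tc_zero_right]
  | succ d ihd =>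
    intro e
    induction e with
    | zero =>
      have h := ihd 1
      rw [Tc_step0]
      have c2 := Nat.choose_succ_right_eq (2 * d + 2) d
      have c3 := Nat.choose_succ_succ (2 * d + 2) d
      rw [show 2 * d + 2 - d = d + 2 by omega] at c2
      rw [show 2 * (d + 1) + 0 + 1 = (2 * d + 2) + 1 by ring, c3]
      rw [show 2 * d + 1 + 1 = 2 * d + 2 by ring] at h
      have c2' : ((Nat.choose (2 * d + 2) (d + 1) : ℕ) : ℚ) * (d + 1)
        = (Nat.choose (2 * d + 2) d : ℕ) * (d + 2) := by exact_mod_cast c2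
      have h0 : (2 * d + 2 : ℚ) ≠ 0 := by positivity
      apply mul_left_cancel₀ h0
      push_cast at h ⊢
      linear_combination (2 * d + 3 : ℚ) * h - 2 * c2'
    | succ e ihe =>
      have h := ihd (e + 2)
      rw [Tc_step]
      have c2 := Nat.choose_succ_right_eq (2 * d + e + 3) d
      have c3 := Nat.choose_succ_succ (2 * d + e + 3) d
      rw [show 2 * d + e + 3 - d = d + e + 3 by omega] at c2
      rw [show 2 * (d + 1) + (e + 1) + 1 = (2 * d + e + 3) + 1 by ring, c3]
      rw [show 2 * d + (e + 2) + 1 = 2 * d + e + 3 by ring] at h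
      rw [show 2 * (d + 1) + e + 1 = 2 * d + e + 3 by ring] at ihe
      have c2' : ((Nat.choose (2 * d + e + 3) (d + 1) : ℕ) : ℚ) * (d + 1)
        = (Nat.choose (2 * d + e + 3) d : ℕ) * (d + e + 3) := by exact_mod_cast c2
      have h0 : (2 * d + e + 3 : ℚ) ≠ 0 := by positivity
      apply mul_left_cancel₀ h0
      push_cast at h ihe ⊢
      linear_combination (2 * d + e + 4 : ℚ) * h + (2 * d + e + 4 : ℚ) * ihe - 2 * c2'

theorem ballot_eq (e d : ℕ) : ballot (d + e + 1) (d + 1) = Tc e d := by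
  have h := Tc_closed d e
  unfold ballot
  have h2 : Nat.choose (d + e + 1 + (d + 1) - 1) (d + e + 1) = Nat.choose (2 * d + e + 1) d := by
    rw [show d + e + 1 + (d + 1) - 1 = d + (d + e + 1) by omega,
      show 2 * d + e + 1 = d + (d + e + 1) by omega, Nat.choose_symm_add]
  rw [h2]
  push_cast at h ⊢
  have h3 : (2 * d + e + 1 : ℚ) ≠ 0 := by positivity
  have h4 : (d + e + 1 + (d + 1) - 1 : ℚ) = 2 * d + e + 1 := by ring
  rw [h4]
  field_simp
  linarith

theorem Tc_conv_range (e d : ℕ) :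
    Tc (e + 1) d = ∑ a ∈ Finset.range (d + 1), catalan a * Tc e (d - a) := by
  rw [Tc_conv, Finset.Nat.sum_antidiagonal_eq_sum_range_succ_mk]

theorem Tc_conv_range' (e d : ℕ) :
    Tc (e + 1) d = ∑ a ∈ Finset.range (d + 1), Tc e a * catalan (d - a) := by
  rw [Tc_conv, ← Finset.Nat.sum_antidiagonal_swap,
    Finset.Nat.sum_antidiagonal_eq_sum_range_succ_mk]
  apply Finset.sum_congr rfl
  intro a _
  simp [mul_comm]

theorem Wcount_formula (n : ℕ) : ∀ A B D E : ℕ, n = A + B + D + E →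
    Wcount (n + 1) (A + B) (A + D) A = catalan A * Tc E B * Tc E D := by
  induction n using Nat.strong_induction_on with
  | _ n ih =>
    intro A B D E hn
    rw [Wcount_succ, Finset.Nat.sum_antidiagonal_eq_sum_range_succ_mk,
      show n.succ = B + (A + 1) + (D + E) by omega, Finset.sum_range_add, Finset.sum_range_add]
    have S1 : ∑ x ∈ Finset.range B, (if A + B < x then
          (if n - x ≤ A + D then Wcount x (A + B) (A + D - (n - x)) A * catalan (n - x) else 0)
        else if A + B = x then (if A + D = n ∧ A = x then catalan x * catalan (n - x) else 0)
        else catalan x * Wcount (n - x) (A + B - x - 1) (A + D) A)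
        = if B = 0 then 0 else catalan A * Tc E D * Tc (E + 1) (B - 1) := by
      rcases B with _ | B
      · simp
      · rw [if_neg (by omega), Nat.add_sub_cancel, Tc_conv_range, Finset.mul_sum]
        apply Finset.sum_congr rfl
        intro x hx
        rw [Finset.mem_range] at hx
        rw [if_neg (by omega), if_neg (by omega)]
        have := ih (n - x - 1) (by omega) A (B - x) D E (by omega)
        rw [show n - x - 1 + 1 = n - x by omega, show A + (B - x) = A + (B + 1) - x - 1 by omega]
          at this
        rw [this]
        ring
    have S2 : ∑ y ∈ Finset.range (A + 1), (if A + B < B + y then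
          (if n - (B + y) ≤ A + D then
            Wcount (B + y) (A + B) (A + D - (n - (B + y))) A * catalan (n - (B + y)) else 0)
        else if A + B = B + y then
          (if A + D = n ∧ A = B + y then catalan (B + y) * catalan (n - (B + y)) else 0)
        else catalan (B + y) * Wcount (n - (B + y)) (A + B - (B + y) - 1) (A + D) A)
        = if B = 0 ∧ E = 0 then catalan A * catalan D else 0 := by
      rw [Finset.sum_range_succ, Finset.sum_eq_zero, zero_add]
      · rw [if_neg (by omega), if_pos (by omega)]
        by_cases h : B = 0 ∧ E = 0
        · rw [if_pos h, if_pos (by omega)]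
          congr 2 <;> omega
        · rw [if_neg h, if_neg (by omega)]
      · intro y hy
        rw [Finset.mem_range] at hy
        rw [if_neg (by omega), if_neg (by omega), Wcount_zero _ _ _ _ (by omega) (by omega),
          mul_zero]
    have S3 : ∑ y ∈ Finset.range (D + E), (if A + B < B + (A + 1) + y then
          (if n - (B + (A + 1) + y) ≤ A + D then
            Wcount (B + (A + 1) + y) (A + B) (A + D - (n - (B + (A + 1) + y))) A
              * catalan (n - (B + (A + 1) + y)) else 0)
        else if A + B = B + (A + 1) + y then
          (if A + D = n ∧ A = B + (A + 1) + y then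
            catalan (B + (A + 1) + y) * catalan (n - (B + (A + 1) + y)) else 0)
        else catalan (B + (A + 1) + y) *
          Wcount (n - (B + (A + 1) + y)) (A + B - (B + (A + 1) + y) - 1) (A + D) A)
        = if E = 0 then 0 else catalan A * Tc (E - 1) B * Tc E D := by
      rcases E with _ | E
      · rw [if_pos rfl]
        apply Finset.sum_eq_zero
        intro y hy
        rw [Finset.mem_range] at hy
        rw [if_pos (by omega), if_pos (by omega), Wcount_zero _ _ _ _ (by omega) (by omega),
          zero_mul]
      · rw [if_neg (by omega), Nat.add_sub_cancel, show D + (E + 1) = E + (D + 1) by omega,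
          Finset.sum_range_add, Finset.sum_eq_zero, zero_add, Tc_conv_range', Finset.mul_sum]
        · apply Finset.sum_congr rfl
          intro y hy
          rw [Finset.mem_range] at hy
          rw [if_pos (by omega), if_pos (by omega)]
          have := ih (A + B + E + y) (by omega) A B y E (by omega)
          rw [show B + (A + 1) + (E + y) = A + B + E + y + 1 by omega,
            show n - (A + B + E + y + 1) = D - y by omega,
            show A + D - (D - y) = A + y by omega, this]
          ring
        · intro y hy
          rw [Finset.mem_range] at hy
          rw [if_pos (by omega)]
          split_ifs with h
          · rw [Wcount_zero _ _ _ _ (by omega) (by omega), zero_mul]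
          · rfl
    have key := congrArg₂ (· + ·) (congrArg₂ (· + ·) S1 S2) S3
    refine Eq.trans key ?_
    clear key S1 S2 S3
    rcases B with _ | B <;> rcases E with _ | E
    · simp [Tc_zero_left]
    · simp [Tc_zero_right]
    · simp [Tc_step0]; ring
    · simp [Tc_step]; ring

/-- Explicit formula for `Q_n(j,k)`: a sum of products of two ballot numbers and a
Catalan number, over `max{0, j+k-n-1} ≤ r ≤ min{j,k} - 1` (note that the lower bound
`j + k - n - 1` is truncated natural subtraction, i.e. `max {0, j+k-n-1}`). -/
theorem Qcount_eq_sum_ballot (n j k : ℕ)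
    (hj1 : 1 ≤ j) (hjn : j ≤ n) (hk1 : 1 ≤ k) (hkn : k ≤ n) :
    (Qcount n j k : ℚ) =
      ∑ r ∈ Finset.Icc (j + k - n - 1) (min j k - 1),
        ballot (n - j + 1) (k - r) * ballot (n - k + 1) (j - r) * (catalan r : ℚ) := by
  obtain ⟨j, rfl⟩ : ∃ j', j = j' + 1 := ⟨j - 1, by omega⟩
  obtain ⟨k, rfl⟩ : ∃ k', k = k' + 1 := ⟨k - 1, by omega⟩
  rw [Qcount_eq_trees n j k (by omega)]
  rw [Finset.card_eq_sum_card_fiberwise (f := fun t => tls t j)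
    (t := Finset.Icc (j + 1 + (k + 1) - n - 1) (min (j + 1) (k + 1) - 1))]
  · rw [Nat.cast_sum]
    apply Finset.sum_congr rfl
    intro r hr
    rw [Finset.mem_Icc] at hr
    rw [Finset.filter_filter]
    have hW := Wcount_formula (n - 1) r (j - r) (k - r) (n - 1 + r - j - k) (by omega)
    rw [show n - 1 + 1 = n by omega, show r + (j - r) = j by omega,
      show r + (k - r) = k by omega] at hW
    unfold Wcount at hW
    rw [hW]
    have b1 := ballot_eq (n - 1 + r - j - k) (k - r)
    have b2 := ballot_eq (n - 1 + r - j - k) (j - r)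
    rw [show k - r + (n - 1 + r - j - k) + 1 = n - (j + 1) + 1 by omega,
      show k - r + 1 = k + 1 - r by omega] at b1
    rw [show j - r + (n - 1 + r - j - k) + 1 = n - (k + 1) + 1 by omega,
      show j - r + 1 = j + 1 - r by omega] at b2
    rw [b1, b2]
    push_cast
    ring
  · intro t ht
    rw [Finset.mem_coe, Finset.mem_filter, BinaryTree.mem_treesOfNumNodesEq] at ht
    have := tls_bounds t j (by omega)
    rw [Finset.mem_coe, Finset.mem_Icc]
    dsimp only
    omega
end
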